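/- Let X be the self-repelling random walk with directed edges and weight function w. Fix s > 0, and for A > 0 let θ_{s/A} be a random variable, independent of X, with geometric distribution Pr(θ_{s/A} = n) = (1 − e^{−s/A})·e^{−sn/A} for n ∈ ℕ. Then for almost every x ∈ ℝ (with respect to Lebesgue measure), A^{1/2}·Pr(X(θ_{s/A}) = ⌊A^{1/2}x⌋) → φ̂(s,x) as A → ∞, where φ̂(s,x) := √(sπ)·(1 − F(√(2s)·|x|)) and F is the standard normal cumulative distribution function. -/

import Mathlib

open MeasureTheory Filter
open scoped BigOperators ENNReal Topology

noncomputable section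

/-- The weight function `w` is positive, nondecreasing and satisfies
`lim_{z→∞} (w(z) - w(-z)) > 0`. -/
def GoodWeight (w : ℤ → ℝ) : Prop :=
  (∀ z, 0 < w z) ∧ (∀ z, w z ≤ w (z + 1)) ∧
    ∃ c > (0 : ℝ), ∀ᶠ z : ℤ in atTop, c ≤ w z - w (-z)

/-- Local time of the path `x` on the oriented edge from `k` to `k+1` up to time `n`. -/
def dirLocP (x : ℕ → ℤ) (n : ℕ) (k : ℤ) : ℕ :=
  ((Finset.range n).filter fun j => x j = k ∧ x (j + 1) = k + 1).card

/-- Local time of the path `x` on the oriented edge from `k` to `k-1` up to time `n`. -/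
def dirLocM (x : ℕ → ℤ) (n : ℕ) (k : ℤ) : ℕ :=
  ((Finset.range n).filter fun j => x j = k ∧ x (j + 1) = k - 1).card

/-- The conditional probability, given the past path `x` up to time `n`, that the
self-repelling walk with weight `w` makes the step `x n → x (n+1)`. -/
def stepProb (w : ℤ → ℝ) (x : ℕ → ℤ) (n : ℕ) : ℝ :=
  let Δ : ℤ := (dirLocP x n (x n) : ℤ) - (dirLocM x n (x n) : ℤ)
  if x (n + 1) = x n + 1 then w (-Δ) / (w Δ + w (-Δ))
  else if x (n + 1) = x n - 1 then w Δ / (w Δ + w (-Δ))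
  else 0

/-- `X` is the self-repelling random walk with directed edges and weight function `w`:
it starts at `0` and its cylinder probabilities evolve by the self-repelling
transition probabilities. -/
def IsSRW {Ω : Type*} [MeasurableSpace Ω] (μ : Measure Ω) (w : ℤ → ℝ)
    (X : ℕ → Ω → ℤ) : Prop :=
  (∀ n, Measurable (X n)) ∧
  μ {ω | X 0 ω = 0} = 1 ∧
  ∀ (n : ℕ) (x : ℕ → ℤ),
    μ {ω | ∀ i ≤ n + 1, X i ω = x i} =
      μ {ω | ∀ i ≤ n, X i ω = x i} * ENNReal.ofReal (stepProb w x n)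

/-- Inverse local time `T⁺_{j,r} = min{n ≥ 0 : ℓ⁺(n,j) ≥ r}` of the path `x`. -/
def Tp (x : ℕ → ℤ) (j : ℤ) (r : ℕ) : ℕ := sInf {n | r ≤ dirLocP x n j}

/-- Inverse local time `T⁻_{j,r} = min{n ≥ 0 : ℓ⁻(n,j) ≥ r}` of the path `x`. -/
def Tm (x : ℕ → ℤ) (j : ℤ) (r : ℕ) : ℕ := sInf {n | r ≤ dirLocM x n j}

/-- `Λ⁺_{j,r}(k) = ℓ⁺(T⁺_{j,r},k) + ℓ⁻(T⁺_{j,r},k+1)`. -/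
def LamP (x : ℕ → ℤ) (j : ℤ) (r : ℕ) (k : ℤ) : ℕ :=
  dirLocP x (Tp x j r) k + dirLocM x (Tp x j r) (k + 1)

/-- `Λ⁻_{j,r}(k) = ℓ⁺(T⁻_{j,r},k) + ℓ⁻(T⁻_{j,r},k+1)`. -/
def LamM (x : ℕ → ℤ) (j : ℤ) (r : ℕ) (k : ℤ) : ℕ :=
  dirLocP x (Tm x j r) k + dirLocM x (Tm x j r) (k + 1)

/-- Leftmost edge `λ⁺_{j,r}` visited before `T⁺_{j,r}`. -/
def lamEdgeP (x : ℕ → ℤ) (j : ℤ) (r : ℕ) : ℤ := sInf {k : ℤ | 0 < LamP x j r k}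

/-- Leftmost edge `λ⁻_{j,r}` visited before `T⁻_{j,r}`. -/
def lamEdgeM (x : ℕ → ℤ) (j : ℤ) (r : ℕ) : ℤ := sInf {k : ℤ | 0 < LamM x j r k}

/-- Rightmost edge `ρ⁺_{j,r}` visited before `T⁺_{j,r}`. -/
def rhoEdgeP (x : ℕ → ℤ) (j : ℤ) (r : ℕ) : ℤ := sSup {k : ℤ | 0 < LamP x j r k}

/-- Rightmost edge `ρ⁻_{j,r}` visited before `T⁻_{j,r}`. -/
def rhoEdgeM (x : ℕ → ℤ) (j : ℤ) (r : ℕ) : ℤ := sSup {k : ℤ | 0 < LamM x j r k}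

/-- The standard normal cumulative distribution function `F`. -/
def stdNormalCdf (x : ℝ) : ℝ :=
  (Real.sqrt (2 * Real.pi))⁻¹ * ∫ y in Set.Iic x, Real.exp (-(y ^ 2) / 2)

/-- `φ̂(s,x) = √(sπ) (1 - F(√(2s)|x|))`. -/
def phiHat (s x : ℝ) : ℝ :=
  Real.sqrt (s * Real.pi) * (1 - stdNormalCdf (Real.sqrt (2 * s) * |x|))

namespace SelfRepelling

/-- A symmetric nearest-neighbour chain on `ℤ` with up-step probabilities `p`, attracted to the
origin, together with its edge conductances `c` (`c z` sits on the edge from `z` to `z + 1`). -/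
structure AttractedChain (p c : ℤ → ℝ) : Prop where
  pos : ∀ z, 0 < p z
  symm : ∀ z, p (-z) = 1 - p z
  le_half : ∀ z, 0 ≤ z → p z ≤ 1 / 2
  lt_half : ∃ z₀ : ℤ, ∀ z, z₀ ≤ z → p z < 1 / 2
  cond_pos : ∀ z, 0 < c z
  cond_zero : c 0 = 1
  cond_symm : ∀ z, c (-1 - z) = c z
  balance : ∀ z, c z * (1 - p z) = c (z - 1) * p z
  decay : ∃ C γ : ℝ, 0 < C ∧ 0 < γ ∧ γ < 1 ∧ ∀ z, c z ≤ C * γ ^ z.natAbs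

/-- Probability that the chain started at `z` makes `u` up-steps before `d` down-steps. -/
def winProb (p : ℤ → ℝ) : ℕ → ℕ → ℤ → ℝ
  | _, 0, _ => 1
  | 0, _ + 1, _ => 0
  | d + 1, u + 1, z => p z * winProb p (d + 1) u (z + 1) + (1 - p z) * winProb p d (u + 1) (z - 1)
termination_by d u => d + u

/-- Probability that the chain started at `z` makes exactly `u` up-steps before its `d`-th
down-step. -/
def upCount (p : ℤ → ℝ) (d u : ℕ) (z : ℤ) : ℝ := winProb p d u z - winProb p d (u + 1) z

/-- The `m`-step transition probabilities. -/
def stepKernel (p : ℤ → ℝ) : ℕ → ℤ → ℤ → ℝ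
  | 0, y, z => if y = z then 1 else 0
  | m + 1, y, z => p y * stepKernel p m (y + 1) z + (1 - p y) * stepKernel p m (y - 1) z

section Recursions

variable (p : ℤ → ℝ)

@[simp] lemma winProb_zero_right (d : ℕ) (z : ℤ) : winProb p d 0 z = 1 := by
  cases d <;> simp [winProb]

@[simp] lemma winProb_zero_left (u : ℕ) (z : ℤ) : winProb p 0 (u + 1) z = 0 := by
  simp [winProb]

lemma winProb_succ (d u : ℕ) (z : ℤ) : winProb p (d + 1) (u + 1) z =
    p z * winProb p (d + 1) u (z + 1) + (1 - p z) * winProb p d (u + 1) (z - 1) := by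
  rw [winProb]

@[simp] lemma upCount_zero_zero (z : ℤ) : upCount p 0 0 z = 1 := by simp [upCount]

@[simp] lemma upCount_zero_succ (u : ℕ) (z : ℤ) : upCount p 0 (u + 1) z = 0 := by simp [upCount]

lemma upCount_succ_zero (d : ℕ) (z : ℤ) :
    upCount p (d + 1) 0 z = (1 - p z) * upCount p d 0 (z - 1) := by
  simp only [upCount, winProb_succ, winProb_zero_right, zero_add]; ring

lemma upCount_succ_succ (d u : ℕ) (z : ℤ) : upCount p (d + 1) (u + 1) z =
    p z * upCount p (d + 1) u (z + 1) + (1 - p z) * upCount p d (u + 1) (z - 1) := by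
  simp only [upCount, winProb_succ]; ring

lemma sum_upCount (d n : ℕ) (z : ℤ) :
    ∑ u ∈ Finset.range n, upCount p d u z = 1 - winProb p d n z := by
  induction n with
  | zero => simp
  | succ n ih => rw [Finset.sum_range_succ, ih, upCount]; ring

lemma stepKernel_succ' (m : ℕ) (y z : ℤ) : stepKernel p (m + 1) y z =
    stepKernel p m y (z - 1) * p (z - 1) + stepKernel p m y (z + 1) * (1 - p (z + 1)) := by
  induction m generalizing y with
  | zero =>
    simp only [stepKernel]
    by_cases h1 : y + 1 = z
    · have h2 : y = z - 1 := by omega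
      subst h2
      have : z - 1 - 1 ≠ z := by omega
      have h3 : z - 1 ≠ z + 1 := by omega
      simp [this, h3]
    · by_cases h2 : y - 1 = z
      · have h3 : y = z + 1 := by omega
        subst h3
        have : z + 1 + 1 ≠ z := by omega
        have h3 : z + 1 ≠ z - 1 := by omega
        simp [this, h3]
      · have h3 : y ≠ z - 1 := by omega
        have h4 : y ≠ z + 1 := by omega
        simp [h1, h2, h3, h4]
  | succ m ih =>
    rw [stepKernel, ih, ih]
    conv_rhs => rw [stepKernel, stepKernel]
    ring

lemma stepKernel_eq_zero (m : ℕ) (y z : ℤ) (h : (m : ℤ) < |y - z|) : stepKernel p m y z = 0 := by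
  induction m generalizing y with
  | zero =>
    have : y ≠ z := by rintro rfl; simp at h
    simp [stepKernel, this]
  | succ m ih =>
    rw [stepKernel, ih, ih]
    · ring
    all_goals
      push_cast at h
      rcases abs_cases (y - z) with h1 | h1 <;>
        rcases abs_cases (y + 1 - z) with h2 | h2 <;>
        rcases abs_cases (y - 1 - z) with h3 | h3 <;> omega

end Recursions

namespace AttractedChain

variable {p c : ℤ → ℝ} (h : AttractedChain p c)
include h

lemma lt_one (z : ℤ) : p z < 1 := by
  have := h.pos (-z); rw [h.symm] at this; linarith

lemma one_sub_pos (z : ℤ) : 0 < 1 - p z := by linarith [h.lt_one z]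

lemma up_mul (z : ℤ) : p z * (c z + c (z - 1)) = c z := by linarith [h.balance z]

lemma down_mul (z : ℤ) : (1 - p z) * (c z + c (z - 1)) = c (z - 1) := by linarith [h.balance z]

lemma stepKernel_nonneg (m : ℕ) (y z : ℤ) : 0 ≤ stepKernel p m y z := by
  induction m generalizing y with
  | zero => simp only [stepKernel]; split_ifs <;> norm_num
  | succ m ih =>
    exact add_nonneg (mul_nonneg (h.pos y).le (ih _)) (mul_nonneg (h.one_sub_pos y).le (ih _))

lemma stepKernel_le_one (m : ℕ) (y z : ℤ) : stepKernel p m y z ≤ 1 := by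
  induction m generalizing y with
  | zero => simp only [stepKernel]; split_ifs <;> norm_num
  | succ m ih =>
    rw [stepKernel]
    nlinarith [h.pos y, h.one_sub_pos y, ih (y + 1), ih (y - 1)]

lemma stepKernel_neg (m : ℕ) (y : ℤ) : stepKernel p m (-y) 0 = stepKernel p m y 0 := by
  induction m generalizing y with
  | zero => simp [stepKernel]
  | succ m ih =>
    rw [stepKernel, stepKernel, h.symm, ← ih (y + 1), ← ih (y - 1)]
    have h1 : -(y + 1) = -y - 1 := by ring
    have h2 : -(y - 1) = -y + 1 := by ring
    rw [h1, h2]; ring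

lemma stepKernel_add_two_le (m : ℕ) (y : ℤ) (hy : 0 ≤ y) :
    stepKernel p m (y + 2) 0 ≤ stepKernel p m y 0 := by
  induction m generalizing y with
  | zero =>
    have : y + 2 ≠ 0 := by omega
    simp only [stepKernel, this, if_false]; split_ifs <;> norm_num
  | succ m ih =>
    have h1 : stepKernel p (m + 1) (y + 2) 0 ≤ stepKernel p m (y + 1) 0 := by
      have := ih (y + 1) (by omega)
      rw [stepKernel]
      have e1 : y + 2 + 1 = y + 1 + 2 := by ring
      have e2 : y + 2 - 1 = y + 1 := by ring
      rw [e1, e2]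
      nlinarith [h.pos (y + 2)]
    have h2 : stepKernel p m (y + 1) 0 ≤ stepKernel p (m + 1) y 0 := by
      have : stepKernel p m (y + 1) 0 ≤ stepKernel p m (y - 1) 0 := by
        rcases hy.eq_or_lt with rfl | hy
        · rw [← h.stepKernel_neg m (0 + 1)]; norm_num
        · have := ih (y - 1) (by omega)
          rwa [show y - 1 + 2 = y + 1 by ring] at this
      rw [stepKernel]
      nlinarith [h.one_sub_pos y]
    exact h1.trans h2

/-- Reversibility expresses `upCount` through the transition kernel run backwards. -/
lemma upCount_eq (d u : ℕ) (z : ℤ) : (c z + c (z - 1)) * upCount p (d + 1) u z =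
    c (z + u - (d + 1)) * stepKernel p (d + u) (z + u - d) z := by
  have hup : ∀ (z : ℤ) (a b : ℝ), (c (z + 1) + c z) * a = b →
      (c z + c (z - 1)) * (p z * a) = (1 - p (z + 1)) * b := by
    intro z a b hab
    have e1 := h.up_mul z
    have e2 := h.down_mul (z + 1)
    rw [add_sub_cancel_right] at e2
    rw [← hab]; linear_combination a * e1 - a * e2
  have hdown : ∀ (z : ℤ) (a b : ℝ), (c (z - 1) + c (z - 1 - 1)) * a = b →
      (c z + c (z - 1)) * ((1 - p z) * a) = p (z - 1) * b := by
    intro z a b hab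
    have e1 := h.down_mul z
    have e2 := h.up_mul (z - 1)
    rw [← hab]; linear_combination a * e1 - a * e2
  induction d generalizing u z with
  | zero =>
    induction u generalizing z with
    | zero =>
      have := h.down_mul z
      simp [upCount_succ_zero, stepKernel]; linarith
    | succ u ih =>
      rw [upCount_succ_succ, upCount_zero_succ, mul_zero, add_zero]
      have e := ih (z + 1)
      rw [add_sub_cancel_right] at e
      rw [hup z _ _ e]
      have e0 : stepKernel p (0 + u) (z + 1 + u - (0 : ℕ)) (z - 1) = 0 := by
        apply stepKernel_eq_zero
        push_cast
        rw [abs_of_nonneg] <;> omega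
      have e1 : 0 + (u + 1) = 0 + u + 1 := by ring
      have e2 : z + ((u + 1 : ℕ) : ℤ) - (0 : ℕ) = z + 1 + u - (0 : ℕ) := by push_cast; ring
      have e3 : z + ((u + 1 : ℕ) : ℤ) - ((0 : ℕ) + 1) = z + 1 + u - ((0 : ℕ) + 1) := by
        push_cast; ring
      rw [e1, stepKernel_succ', e2, e3, e0]
      ring
  | succ d ihd =>
    induction u generalizing z with
    | zero =>
      rw [upCount_succ_zero, hdown z _ _ (ihd 0 (z - 1))]
      have e0 : stepKernel p (d + 0) (z - 1 + (0 : ℕ) - d) (z + 1) = 0 := by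
        apply stepKernel_eq_zero
        push_cast
        rw [abs_of_nonpos] <;> omega
      have e1 : d + 1 + 0 = d + 0 + 1 := by ring
      have e2 : z + ((0 : ℕ) : ℤ) - (d + 1 : ℕ) = z - 1 + (0 : ℕ) - d := by push_cast; ring
      have e3 : z + ((0 : ℕ) : ℤ) - ((d + 1 : ℕ) + 1) = z - 1 + (0 : ℕ) - (d + 1) := by
        push_cast; ring
      rw [add_zero] at e0
      rw [e1, stepKernel_succ', e2, e3, add_zero, e0]
      ring
    | succ u ihu =>
      have e := ihu (z + 1)
      rw [add_sub_cancel_right] at e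
      rw [upCount_succ_succ, mul_add, hup z _ _ e, hdown z _ _ (ihd (u + 1) (z - 1))]
      have e1 : d + 1 + (u + 1) = d + 1 + u + 1 := by ring
      have e1' : d + (u + 1) = d + 1 + u := by ring
      have e2 : z + 1 + (u : ℤ) - (d + 1 : ℕ) = z + ((u + 1 : ℕ) : ℤ) - (d + 1 : ℕ) := by
        push_cast; ring
      have e3 : z + 1 + (u : ℤ) - ((d + 1 : ℕ) + 1) = z + ((u + 1 : ℕ) : ℤ) - ((d + 1 : ℕ) + 1) := by
        push_cast; ring
      have e4 : z - 1 + ((u + 1 : ℕ) : ℤ) - d = z + ((u + 1 : ℕ) : ℤ) - (d + 1 : ℕ) := by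
        push_cast; ring
      have e5 : z - 1 + ((u + 1 : ℕ) : ℤ) - (d + 1) = z + ((u + 1 : ℕ) : ℤ) - ((d + 1 : ℕ) + 1) := by
        push_cast; ring
      rw [e1, stepKernel_succ', e1', e2, e3, e4, e5]
      ring

lemma upCount_nonneg (d u : ℕ) (z : ℤ) : 0 ≤ upCount p d u z := by
  cases d with
  | zero => cases u <;> simp
  | succ d =>
    have e := h.upCount_eq d u z
    have h1 : 0 < c z + c (z - 1) := add_pos (h.cond_pos z) (h.cond_pos _)
    have h2 := mul_nonneg (h.cond_pos (z + u - (d + 1))).le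
      (h.stepKernel_nonneg (d + u) (z + u - d) z)
    rw [← e] at h2
    exact nonneg_of_mul_nonneg_right h2 h1

lemma upCount_mul_le (d u : ℕ) (z : ℤ) :
    (c z + c (z - 1)) * upCount p (d + 1) u z ≤ c (z + u - (d + 1)) := by
  rw [h.upCount_eq]
  exact mul_le_of_le_one_right (h.cond_pos _).le (h.stepKernel_le_one _ _ _)

lemma cond_neg_one : c (-1) = 1 := by
  have := h.cond_symm 0; rw [h.cond_zero] at this; simpa using this

lemma upCount_le (d u : ℕ) : upCount p d u 0 ≤ c (u - d) := by
  cases d with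
  | zero =>
    cases u with
    | zero => simp [h.cond_zero]
    | succ u => simpa using (h.cond_pos _).le
  | succ d =>
    have e := h.upCount_mul_le d u 0
    have h0 := h.upCount_nonneg (d + 1) u 0
    rw [h.cond_zero, zero_sub, h.cond_neg_one, zero_add] at e
    push_cast
    linarith

lemma winProb_nonneg (d u : ℕ) (z : ℤ) : 0 ≤ winProb p d u z := by
  induction d generalizing u z with
  | zero => cases u <;> simp
  | succ d ihd =>
    induction u generalizing z with
    | zero => simp
    | succ u ihu =>
      rw [winProb_succ]
      exact add_nonneg (mul_nonneg (h.pos z).le (ihu _)) (mul_nonneg (h.one_sub_pos z).le (ihd _ _))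

lemma winProb_add (d u : ℕ) (z : ℤ) (hdu : d ≠ 0 ∨ u ≠ 0) :
    winProb p d u z + winProb p u d (-z) = 1 := by
  induction d generalizing u z with
  | zero =>
    obtain ⟨u, rfl⟩ := Nat.exists_eq_succ_of_ne_zero (by simpa using hdu)
    simp
  | succ d ihd =>
    induction u generalizing z with
    | zero => simp
    | succ u ihu =>
      have e1 := ihu (z + 1) (by simp)
      have e2 := ihd (u + 1) (z - 1) (by simp)
      rw [winProb_succ, winProb_succ, h.symm]
      rw [show -(z + 1) = -z - 1 by ring] at e1
      rw [show -(z - 1) = -z + 1 by ring] at e2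
      linear_combination p z * e1 + (1 - p z) * e2

lemma winProb_diag (d : ℕ) (hd : d ≠ 0) : winProb p d d 0 = 1 / 2 := by
  have := h.winProb_add d d 0 (.inl hd)
  simp at this; linarith

lemma winProb_succ_sub (d u : ℕ) (z : ℤ) (hdu : d ≠ 0 ∨ u ≠ 0) :
    winProb p (d + 1) (u + 1) z - winProb p d u z =
      upCount p u d (-z) * p (z + u - d) - upCount p d u z * (1 - p (z + u - d)) := by
  induction d generalizing u z with
  | zero =>
    obtain ⟨u, rfl⟩ := Nat.exists_eq_succ_of_ne_zero (by simpa using hdu)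
    clear hdu
    induction u generalizing z with
    | zero =>
      simp [winProb_succ, upCount_succ_zero, h.symm]
    | succ u ih =>
      have e := ih (z + 1)
      simp only [Nat.succ_eq_add_one] at e ⊢
      rw [winProb_succ, upCount_succ_zero, h.symm]
      simp only [winProb_zero_left, upCount_zero_succ] at e ⊢
      have e1 : z + 1 + ((u + 1 : ℕ) : ℤ) - (0 : ℕ) = z + ((u + 1 + 1 : ℕ) : ℤ) - (0 : ℕ) := by
        push_cast; ring
      rw [show -(z + 1) = -z - 1 by ring, e1] at e
      linear_combination p z * e
  | succ d ihd =>
    clear hdu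
    induction u generalizing z with
    | zero =>
      clear ihd
      simp only [winProb_zero_right, upCount_zero_succ]
      induction d generalizing z with
      | zero => simp [winProb_succ, upCount_succ_zero]; ring
      | succ d ih =>
        have e := ih (z - 1)
        rw [winProb_succ, upCount_succ_zero]
        have e1 : z - 1 + ((0 : ℕ) : ℤ) - (d + 1 : ℕ) = z + ((0 : ℕ) : ℤ) - (d + 1 + 1 : ℕ) := by
          push_cast; ring
        rw [e1] at e
        simp only [winProb_zero_right] at e ⊢
        linear_combination (1 - p z) * e
    | succ u ihu =>
      have e1 := ihu (z + 1)
      have e2 := ihd (u + 1) (z - 1) (by simp)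
      rw [winProb_succ p (d + 1), winProb_succ p d u, upCount_succ_succ p d u,
        upCount_succ_succ p u d, h.symm]
      rw [show -(z + 1) = -z - 1 by ring] at e1
      rw [show -(z - 1) = -z + 1 by ring] at e2
      have e3 : z + 1 + (u : ℤ) - (d + 1 : ℕ) = z + ((u + 1 : ℕ) : ℤ) - (d + 1 : ℕ) := by
        push_cast; ring
      have e4 : z - 1 + ((u + 1 : ℕ) : ℤ) - d = z + ((u + 1 : ℕ) : ℤ) - (d + 1 : ℕ) := by
        push_cast; ring
      rw [e3] at e1
      rw [e4] at e2
      linear_combination p z * e1 + (1 - p z) * e2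

/-- The tails of the up-step surplus at successive down-steps are monotone. -/
lemma winProb_mono_diag (m : ℕ) (hm : m ≠ 0) : Monotone fun d => winProb p d (d + m) 0 := by
  refine monotone_nat_of_le_succ fun d => ?_
  show winProb p d (d + m) 0 ≤ winProb p (d + 1) (d + 1 + m) 0
  cases d with
  | zero =>
    obtain ⟨m, rfl⟩ := Nat.exists_eq_succ_of_ne_zero hm
    simpa [add_comm] using h.winProb_nonneg 1 (1 + (m + 1)) 0
  | succ d =>
    have e := h.winProb_succ_sub (d + 1) (d + 1 + m) 0 (by simp)
    obtain ⟨m, rfl⟩ := Nat.exists_eq_succ_of_ne_zero hm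
    have e1 := h.upCount_eq d (d + 1 + (m + 1)) 0
    have e2 := h.upCount_eq (d + m + 1) (d + 1) 0
    rw [h.cond_zero, zero_sub, h.cond_neg_one] at e1 e2
    simp only [Nat.succ_eq_add_one] at *
    have a1 : (0 : ℤ) + ((d + 1 + (m + 1) : ℕ) : ℤ) - ((d : ℤ) + 1) = m + 1 := by push_cast; ring
    have a2 : (0 : ℤ) + ((d + 1 + (m + 1) : ℕ) : ℤ) - (d : ℤ) = m + 2 := by push_cast; ring
    have a3 : (0 : ℤ) + ((d + 1 : ℕ) : ℤ) - (((d + m + 1 : ℕ) : ℤ) + 1) = -1 - m := by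
      push_cast; ring
    have a4 : (0 : ℤ) + ((d + 1 : ℕ) : ℤ) - ((d + m + 1 : ℕ) : ℤ) = -m := by push_cast; ring
    have a5 : (0 : ℤ) + ((d + 1 + (m + 1) : ℕ) : ℤ) - ((d + 1 : ℕ) : ℤ) = m + 1 := by
      push_cast; ring
    have a6 : d + m + 1 + (d + 1) = d + (d + 1 + (m + 1)) := by ring
    have a7 : d + m + 1 + 1 = d + 1 + (m + 1) := by ring
    rw [a1, a2] at e1
    rw [a3, a4, h.cond_symm, h.stepKernel_neg, a6, a7] at e2
    rw [a5, neg_zero] at e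
    have b := h.balance (m + 1)
    rw [add_sub_cancel_right] at b
    have k := h.stepKernel_add_two_le (d + (d + 1 + (m + 1))) m (by omega)
    have key : 0 ≤ (c m * p (m + 1)) * (stepKernel p (d + (d + 1 + (m + 1))) m 0 -
        stepKernel p (d + (d + 1 + (m + 1))) (m + 2) 0) :=
      mul_nonneg (mul_nonneg (h.cond_pos _).le (h.pos _).le) (by linarith)
    have e3 : d + 1 + (m + 1) + 1 = d + 1 + 1 + (m + 1) := by ring
    rw [e3] at e
    have : 2 * (winProb p (d + 1 + 1) (d + 1 + 1 + (m + 1)) 0 -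
        winProb p (d + 1) (d + 1 + (m + 1)) 0) = (c m * p (m + 1)) *
        (stepKernel p (d + (d + 1 + (m + 1))) m 0 -
        stepKernel p (d + (d + 1 + (m + 1))) (m + 2) 0) := by
      linear_combination 2 * e + p (m + 1) * e2 - (1 - p (m + 1)) * e1 -
        stepKernel p (d + (d + 1 + (m + 1))) (m + 2) 0 * b
    linarith

end AttractedChain

end SelfRepelling

namespace SelfRepelling

/-- Expected number of up-steps made by the chain started at `z` before its `d`-th down-step. -/
def meanUp (p : ℤ → ℝ) (d : ℕ) (z : ℤ) : ℝ := ∑' u : ℕ, winProb p d (u + 1) z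

/-- Expected position of the chain started at `0` after its `d`-th down-step. -/
def drift (p : ℤ → ℝ) (d : ℕ) : ℝ := meanUp p d 0 - d

namespace AttractedChain

variable {p c : ℤ → ℝ} (h : AttractedChain p c)
include h

lemma winProb_le_one (d u : ℕ) (z : ℤ) : winProb p d u z ≤ 1 := by
  by_cases hdu : d ≠ 0 ∨ u ≠ 0
  · linarith [h.winProb_add d u z hdu, h.winProb_nonneg u d (-z)]
  · push Not at hdu
    simp [hdu.1, hdu.2]

/-- The tails of the number of up-steps decay geometrically. -/
lemma exists_winProb_le : ∃ γ : ℝ, 0 < γ ∧ γ < 1 ∧ ∀ z : ℤ, ∃ C : ℝ, 0 < C ∧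
    ∀ d m : ℕ, winProb p d (d + m + 1) z ≤ C * γ ^ m := by
  obtain ⟨C, γ, hC, h0, h1, hc⟩ := h.decay
  refine ⟨γ, h0, h1, fun z => ?_⟩
  have hz : 0 < c (-z) + c (-z - 1) := add_pos (h.cond_pos _) (h.cond_pos _)
  have hg : (0 : ℝ) < γ ^ (z.natAbs) := by positivity
  set K : ℝ := C / (c (-z) + c (-z - 1)) / γ ^ (z.natAbs) with hK
  have hK0 : 0 < K := by positivity
  have bound : ∀ u l j : ℕ, l + j = u + 1 → upCount p (u + 1) l (-z) ≤ K * γ ^ j := by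
    intro u l j hj
    have e := (h.upCount_mul_le u l (-z)).trans (hc _)
    have e2 : γ ^ (-z + (l : ℤ) - ((u : ℤ) + 1)).natAbs * γ ^ z.natAbs ≤ γ ^ j := by
      rw [← pow_add]
      exact pow_le_pow_of_le_one h0.le h1.le (by omega)
    rw [hK, div_div, div_mul_eq_mul_div, le_div_iff₀ (by positivity)]
    calc upCount p (u + 1) l (-z) * ((c (-z) + c (-z - 1)) * γ ^ z.natAbs)
        = ((c (-z) + c (-z - 1)) * upCount p (u + 1) l (-z)) * γ ^ z.natAbs := by ring
      _ ≤ C * γ ^ (-z + (l : ℤ) - ((u : ℤ) + 1)).natAbs * γ ^ z.natAbs := by gcongr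
      _ = C * (γ ^ (-z + (l : ℤ) - ((u : ℤ) + 1)).natAbs * γ ^ z.natAbs) := by ring
      _ ≤ C * γ ^ j := by gcongr
  refine ⟨K * (1 - γ)⁻¹, mul_pos hK0 (inv_pos.2 (by linarith)), fun d m => ?_⟩
  have e : winProb p d (d + m + 1) z = ∑ l ∈ Finset.range d, upCount p (d + m + 1) l (-z) := by
    have := h.winProb_add d (d + m + 1) z (by simp)
    rw [sum_upCount]; linarith
  rw [e, ← Finset.sum_range_reflect]
  calc ∑ j ∈ Finset.range d, upCount p (d + m + 1) (d - 1 - j) (-z)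
      ≤ ∑ j ∈ Finset.range d, K * γ ^ m * γ ^ j := by
        refine Finset.sum_le_sum fun j hj => ?_
        rw [Finset.mem_range] at hj
        refine (bound (d + m) (d - 1 - j) (m + j + 2) (by omega)).trans ?_
        rw [mul_assoc, ← pow_add]
        exact mul_le_mul_of_nonneg_left (pow_le_pow_of_le_one h0.le h1.le (by omega)) hK0.le
    _ = K * γ ^ m * ∑ j ∈ Finset.range d, γ ^ j := by rw [Finset.mul_sum]
    _ ≤ K * γ ^ m * (1 - γ)⁻¹ := by
        gcongr
        rw [← tsum_geometric_of_lt_one h0.le h1]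
        exact (summable_geometric_of_lt_one h0.le h1).sum_le_tsum _ (fun _ _ => by positivity)
    _ = _ := by ring

lemma summable_winProb (d : ℕ) (z : ℤ) : Summable fun u : ℕ => winProb p d (u + 1) z := by
  obtain ⟨γ, h0, h1, H⟩ := h.exists_winProb_le
  obtain ⟨C, hC, H⟩ := H z
  rw [← summable_nat_add_iff d]
  refine Summable.of_nonneg_of_le (fun m => h.winProb_nonneg _ _ _) (fun m => ?_)
    ((summable_geometric_of_lt_one h0.le h1).mul_left C)
  have := H d m
  rwa [add_comm d m] at this

omit h in
lemma meanUp_zero (z : ℤ) : meanUp p 0 z = 0 := by simp [meanUp]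

omit h in
lemma drift_zero : drift p 0 = 0 := by simp [drift, meanUp_zero]

lemma meanUp_succ (d : ℕ) (z : ℤ) : meanUp p (d + 1) z =
    p z * (1 + meanUp p (d + 1) (z + 1)) + (1 - p z) * meanUp p d (z - 1) := by
  have e1 : Summable fun u : ℕ => winProb p (d + 1) u (z + 1) :=
    (summable_nat_add_iff 1).1 (h.summable_winProb (d + 1) (z + 1))
  have e2 := h.summable_winProb d (z - 1)
  have e3 : ∑' u : ℕ, winProb p (d + 1) u (z + 1) = 1 + meanUp p (d + 1) (z + 1) := by
    rw [e1.tsum_eq_zero_add, winProb_zero_right, meanUp]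
  rw [← e3]
  unfold meanUp
  rw [← tsum_mul_left, ← tsum_mul_left, ← (e1.mul_left _).tsum_add (e2.mul_left _)]
  exact tsum_congr fun u => winProb_succ p d u z

lemma meanUp_le (d : ℕ) (z : ℤ) (hz : (d : ℤ) ≤ z) : meanUp p d z ≤ d := by
  refine (h.summable_winProb d z).tsum_le_of_sum_range_le fun N => ?_
  induction d generalizing N z with
  | zero => simp
  | succ d ihd =>
    induction N generalizing z with
    | zero => simp; positivity
    | succ N ihN =>
      have e : ∑ u ∈ Finset.range (N + 1), winProb p (d + 1) (u + 1) z =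
          p z * (1 + ∑ u ∈ Finset.range N, winProb p (d + 1) (u + 1) (z + 1)) +
          (1 - p z) * ∑ u ∈ Finset.range (N + 1), winProb p d (u + 1) (z - 1) := by
        simp only [winProb_succ p d _ z]
        rw [Finset.sum_add_distrib, ← Finset.mul_sum, ← Finset.mul_sum, Finset.sum_range_succ',
          winProb_zero_right, add_comm _ (1 : ℝ)]
      rw [e]
      have a1 := ihN (z + 1) (by omega)
      have a2 := ihd (z - 1) (by push_cast at hz; omega) (N + 1)
      have a3 := h.le_half z (by push_cast at hz; omega)
      have a4 := h.pos z
      push_cast at *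
      nlinarith

lemma meanUp_lt (d : ℕ) (z : ℤ) (hz : (d : ℤ) + 1 ≤ z) : meanUp p (d + 1) z < d + 1 := by
  obtain ⟨z₀, hz₀⟩ := h.lt_half
  have step : ∀ z : ℤ, (d : ℤ) + 1 ≤ z →
      (p z < 1 / 2 ∨ meanUp p (d + 1) (z + 1) < d + 1) → meanUp p (d + 1) z < d + 1 := by
    intro z hz hh
    have a1 := h.meanUp_le (d + 1) (z + 1) (by push_cast; omega)
    have a2 := h.meanUp_le d (z - 1) (by omega)
    have a3 := h.le_half z (by omega)
    have a4 := h.pos z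
    rw [h.meanUp_succ]
    push_cast at *
    rcases hh with hh | hh <;> nlinarith
  have main : ∀ n : ℕ, ∀ z : ℤ, (d : ℤ) + 1 ≤ z → z₀ ≤ z + n → meanUp p (d + 1) z < d + 1 := by
    intro n
    induction n with
    | zero => exact fun z hz hn => step z hz (.inl (hz₀ z (by simpa using hn)))
    | succ n ih =>
      exact fun z hz hn => step z hz (.inr (ih (z + 1) (by omega) (by push_cast at hn; omega)))
  exact main (z₀ - z).toNat z hz (by omega)

/-- The drift is negative away from `0`. -/
lemma drift_neg (d : ℕ) (hd : d ≠ 0) : drift p d < 0 := by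
  set H : ℕ → ℕ → ℝ := fun d e => (meanUp p d (d - e) - e) + (meanUp p e (e - d) - d) with hH
  have hsymm : ∀ d e, H d e = H e d := fun d e => by simp only [hH]; ring
  have h0 : ∀ d, H (d + 1) 0 < 0 := by
    intro d
    have := h.meanUp_lt d (d + 1) le_rfl
    simp only [hH, meanUp_zero]
    push_cast
    simp only [sub_zero]
    linarith
  have hrec : ∀ d e : ℕ, H (d + 1) (e + 1) =
      p (d - e) * H (d + 1) e + (1 - p (d - e)) * H d (e + 1) := by
    intro d e
    simp only [hH]
    rw [h.meanUp_succ, h.meanUp_succ e]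
    have e1 : ((d + 1 : ℕ) : ℤ) - ((e + 1 : ℕ) : ℤ) = d - e := by push_cast; ring
    have e2 : ((e + 1 : ℕ) : ℤ) - ((d + 1 : ℕ) : ℤ) = -(d - e) := by push_cast; ring
    have e3 : (d : ℤ) - e + 1 = ((d + 1 : ℕ) : ℤ) - e := by push_cast; ring
    have e4 : (d : ℤ) - e - 1 = d - ((e + 1 : ℕ) : ℤ) := by push_cast; ring
    have e5 : -((d : ℤ) - e) + 1 = ((e + 1 : ℕ) : ℤ) - d := by push_cast; ring
    have e6 : -((d : ℤ) - e) - 1 = e - ((d + 1 : ℕ) : ℤ) := by push_cast; ring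
    rw [e1, e2, h.symm, e3, e4, e5, e6]
    push_cast
    ring
  have hneg : ∀ d e : ℕ, d + e ≠ 0 → H d e < 0 := by
    intro d
    induction d with
    | zero =>
      intro e he
      obtain ⟨e, rfl⟩ := Nat.exists_eq_succ_of_ne_zero (by simpa using he)
      rw [hsymm]; exact h0 e
    | succ d ihd =>
      intro e
      induction e with
      | zero => exact fun _ => h0 d
      | succ e ihe =>
        intro _
        rw [hrec]
        have a1 := ihe (by omega)
        have a2 := ihd (e + 1) (by omega)
        nlinarith [mul_pos (h.pos (d - e)) (neg_pos.2 a1),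
          mul_pos (h.one_sub_pos (d - e)) (neg_pos.2 a2)]
  have := hneg d d (by omega)
  simp only [hH, sub_self] at this
  rw [drift]; linarith

lemma drift_add_half (d : ℕ) (hd : d ≠ 0) : HasSum (fun m : ℕ => winProb p d (d + (m + 1)) 0 -
    if m + 1 < d then winProb p (d - (m + 1)) (d - (m + 1) + (m + 1)) 0 else 0)
    (drift p d + 1 / 2) := by
  obtain ⟨d, rfl⟩ := Nat.exists_eq_succ_of_ne_zero hd
  clear hd
  simp only [Nat.succ_eq_add_one]
  have s := h.summable_winProb (d + 1) 0
  have e1 : drift p (d + 1) + 1 / 2 = (∑' m : ℕ, winProb p (d + 1) (d + 1 + (m + 1)) 0) -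
      ∑ m ∈ Finset.range d, (1 - winProb p (d + 1) (d - m) 0) := by
    rw [drift, meanUp, ← s.sum_add_tsum_nat_add (d + 1), Finset.sum_range_succ,
      h.winProb_diag (d + 1) (by omega), Finset.sum_sub_distrib, ← Finset.sum_range_reflect]
    have : ∑ j ∈ Finset.range d, winProb p (d + 1) (d - 1 - j + 1) 0 =
        ∑ j ∈ Finset.range d, winProb p (d + 1) (d - j) 0 := by
      refine Finset.sum_congr rfl fun j hj => ?_
      rw [Finset.mem_range] at hj
      congr 1; omega
    rw [this]
    have : ∀ i, i + (d + 1) + 1 = d + 1 + (i + 1) := fun i => by ring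
    simp only [this]
    simp
    ring
  rw [e1]
  refine HasSum.sub ?_ ?_
  · have := (summable_nat_add_iff (d + 1)).2 s
    have e : ∀ i, i + (d + 1) + 1 = d + 1 + (i + 1) := fun i => by ring
    simp only [e] at this
    exact this.hasSum
  · have : ∀ m ∈ Finset.range d, 1 - winProb p (d + 1) (d - m) 0 =
        if m + 1 < d + 1 then winProb p (d + 1 - (m + 1)) (d + 1 - (m + 1) + (m + 1)) 0 else 0 := by
      intro m hm
      rw [Finset.mem_range] at hm
      have e := h.winProb_add (d + 1) (d - m) 0 (by simp)
      rw [if_pos (by omega), show d + 1 - (m + 1) = d - m by omega,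
        show d - m + (m + 1) = d + 1 by omega]
      rw [neg_zero] at e
      linarith
    rw [Finset.sum_congr rfl this]
    refine hasSum_sum_of_ne_finset_zero fun m hm => ?_
    rw [Finset.mem_range] at hm
    rw [if_neg (by omega)]

lemma neg_half_le_drift (d : ℕ) : -(1 / 2) ≤ drift p d := by
  rcases eq_or_ne d 0 with rfl | hd
  · rw [drift_zero]; norm_num
  · have := (h.drift_add_half d hd).nonneg fun m => by
      split_ifs with hm
      · exact sub_nonneg.2 (h.winProb_mono_diag (m + 1) (by omega) (Nat.sub_le _ _))
      · simpa using h.winProb_nonneg _ _ _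
    linarith

lemma drift_nonpos (d : ℕ) : drift p d ≤ 0 := by
  rcases eq_or_ne d 0 with rfl | hd
  · rw [drift_zero]
  · exact (h.drift_neg d hd).le

lemma tendsto_drift : Tendsto (drift p) atTop (𝓝 (-(1 / 2))) := by
  obtain ⟨γ, h0, h1, H⟩ := h.exists_winProb_le
  obtain ⟨C, hC, H⟩ := H 0
  have hlim : ∀ m : ℕ, ∃ l, Tendsto (fun d => winProb p d (d + (m + 1)) 0) atTop (𝓝 l) := by
    intro m
    refine ⟨_, tendsto_atTop_ciSup (h.winProb_mono_diag (m + 1) (by omega)) ⟨1, ?_⟩⟩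
    rintro _ ⟨d, rfl⟩
    exact h.winProb_le_one _ _ _
  have key : Tendsto (fun d : ℕ => ∑' m : ℕ, (winProb p d (d + (m + 1)) 0 -
      if m + 1 < d then winProb p (d - (m + 1)) (d - (m + 1) + (m + 1)) 0 else 0))
      atTop (𝓝 (∑' _ : ℕ, (0 : ℝ))) := by
    refine tendsto_tsum_of_dominated_convergence (bound := fun m => C * γ ^ m)
      ((summable_geometric_of_lt_one h0.le h1).mul_left C) (fun m => ?_)
      (.of_forall fun d m => ?_)
    · obtain ⟨l, hl⟩ := hlim m
      have h2 : Tendsto (fun d => winProb p (d - (m + 1)) (d - (m + 1) + (m + 1)) 0) atTop (𝓝 l) :=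
        hl.comp (tendsto_sub_atTop_nat (m + 1))
      have := hl.sub h2
      rw [sub_self] at this
      refine this.congr' ?_
      filter_upwards [eventually_gt_atTop (m + 1)] with d hd
      rw [if_pos hd]
    · have e := H d m
      have e2 := h.winProb_nonneg d (d + (m + 1)) 0
      have e3 : d + m + 1 = d + (m + 1) := by ring
      rw [e3] at e
      rw [Real.norm_eq_abs, abs_of_nonneg]
      · split_ifs
        · linarith [h.winProb_nonneg (d - (m + 1)) (d - (m + 1) + (m + 1)) 0]
        · linarith
      · split_ifs with hm
        · exact sub_nonneg.2 (h.winProb_mono_diag (m + 1) (by omega) (Nat.sub_le _ _))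
        · simpa using e2
  rw [tsum_zero] at key
  have := key.sub_const (1 / 2)
  rw [zero_sub] at this
  refine this.congr' ?_
  filter_upwards [eventually_ne_atTop 0] with d hd
  rw [(h.drift_add_half d hd).tsum_eq]; ring

/-- The drift is bounded away from `0` on the positive integers. -/
lemma exists_drift_le : ∃ θ : ℝ, 0 < θ ∧ ∀ d : ℕ, d ≠ 0 → drift p d ≤ -θ := by
  have h1 : ∀ᶠ d in atTop, drift p d < -(1 / 4) :=
    h.tendsto_drift.eventually_lt_const (by norm_num)
  obtain ⟨N, hN⟩ := eventually_atTop.1 h1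
  have : ∀ n : ℕ, ∃ θ : ℝ, 0 < θ ∧ ∀ d : ℕ, d ≠ 0 → d < n → drift p d ≤ -θ := by
    intro n
    induction n with
    | zero => exact ⟨1, one_pos, fun d _ hd => absurd hd (by omega)⟩
    | succ n ih =>
      obtain ⟨θ, h0, hθ⟩ := ih
      rcases eq_or_ne n 0 with rfl | hn
      · exact ⟨1, one_pos, fun d h1 hd => absurd hd (by omega)⟩
      refine ⟨min θ (-drift p n), lt_min h0 (by linarith [h.drift_neg n hn]), fun d hd hdn => ?_⟩
      rcases Nat.lt_succ_iff_lt_or_eq.1 hdn with hlt | rfl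
      · linarith [hθ d hd hlt, min_le_left θ (-drift p n)]
      · linarith [min_le_right θ (-drift p d)]
  obtain ⟨θ, h0, hθ⟩ := this N
  refine ⟨min θ (1 / 4), lt_min h0 (by norm_num), fun d hd => ?_⟩
  rcases lt_or_ge d N with hlt | hge
  · linarith [hθ d hd hlt, min_le_left θ (1 / 4)]
  · linarith [hN d hge, min_le_right θ (1 / 4)]

end AttractedChain

end SelfRepelling

namespace SelfRepelling

lemma exp_le_one_add_sq (y : ℝ) : Real.exp y ≤ 1 + y + y ^ 2 * Real.exp |y| := by
  have := Complex.norm_exp_sub_sum_le_norm_mul_exp (y : ℂ) 2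
  rw [Finset.sum_range_succ, Finset.sum_range_one] at this
  simp only [pow_zero, Nat.factorial, Nat.cast_one, div_one, pow_one, mul_one] at this
  norm_cast at this
  rw [Real.norm_eq_abs, Real.norm_eq_abs, sq_abs] at this
  linarith [(abs_le.1 this).2]

namespace AttractedChain

variable {p c : ℤ → ℝ} (h : AttractedChain p c)
include h

lemma tendsto_mul_winProb (d : ℕ) (z : ℤ) :
    Tendsto (fun n : ℕ => (n : ℝ) * winProb p d n z) atTop (𝓝 0) := by
  obtain ⟨γ, h0, h1, H⟩ := h.exists_winProb_le
  obtain ⟨C, hC, H⟩ := H z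
  rw [← tendsto_add_atTop_iff_nat (d + 1)]
  have e1 := (tendsto_self_mul_const_pow_of_lt_one h0.le h1).const_mul C
  have e2 := (tendsto_pow_atTop_nhds_zero_of_lt_one h0.le h1).const_mul ((d + 1) * C)
  have e3 := e1.add e2
  simp only [mul_zero, add_zero] at e3
  refine squeeze_zero (fun m => mul_nonneg (Nat.cast_nonneg _) (h.winProb_nonneg _ _ _))
    (fun m => ?_) e3
  have := H d m
  rw [show m + (d + 1) = d + m + 1 by ring]
  calc ((d + m + 1 : ℕ) : ℝ) * winProb p d (d + m + 1) z
      ≤ ((d + m + 1 : ℕ) : ℝ) * (C * γ ^ m) := by gcongr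
    _ = _ := by push_cast; ring

lemma tendsto_winProb (d : ℕ) (z : ℤ) : Tendsto (fun n : ℕ => winProb p d n z) atTop (𝓝 0) := by
  rw [← tendsto_add_atTop_iff_nat 1]
  exact (h.summable_winProb d z).tendsto_atTop_zero

omit h in
lemma sum_upCount_mul (d n : ℕ) (z : ℤ) : ∑ u ∈ Finset.range n, upCount p d u z * u =
    ∑ u ∈ Finset.range n, winProb p d (u + 1) z - n * winProb p d n z := by
  induction n with
  | zero => simp
  | succ n ih =>
    rw [Finset.sum_range_succ, Finset.sum_range_succ, ih, upCount]; push_cast; ring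

lemma tendsto_sum_upCount_mul (d : ℕ) (l : ℝ) : Tendsto (fun n : ℕ => ∑ u ∈ Finset.range n,
    upCount p d u 0 * (1 + l * (u - d - drift p d))) atTop (𝓝 1) := by
  have e : ∀ n : ℕ, ∑ u ∈ Finset.range n, upCount p d u 0 * (1 + l * (u - d - drift p d)) =
      (1 - l * meanUp p d 0) * (1 - winProb p d n 0) +
      l * (∑ u ∈ Finset.range n, winProb p d (u + 1) 0 - n * winProb p d n 0) := by
    intro n
    rw [← sum_upCount, ← sum_upCount_mul, Finset.mul_sum, Finset.mul_sum, ← Finset.sum_add_distrib]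
    refine Finset.sum_congr rfl fun u _ => ?_
    rw [drift]; ring
  simp only [e]
  have t1 := ((h.tendsto_winProb d 0).const_sub 1).const_mul (1 - l * meanUp p d 0)
  have t2 := (((h.summable_winProb d 0).hasSum.tendsto_sum_nat).sub
    (h.tendsto_mul_winProb d 0)).const_mul l
  have := t1.add t2
  convert this using 2
  rw [meanUp]; ring

/-- Uniform sub-Gaussian bound for the centred number of up-steps. -/
lemma exists_exp_moment_le : ∃ K l₀ : ℝ, 0 < K ∧ 0 < l₀ ∧ ∀ (d n : ℕ) (l : ℝ), |l| ≤ l₀ →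
    ∑ u ∈ Finset.range n, upCount p d u 0 * Real.exp (l * (u - d - drift p d)) ≤
      Real.exp (K * l ^ 2) := by
  obtain ⟨C, γ, hC, h0, h1, hc⟩ := h.decay
  have hlog : Real.log γ < 0 := Real.log_neg h0 h1
  set l₀ : ℝ := -Real.log γ / 2 with hl₀
  set r : ℝ := γ * Real.exp l₀ with hr
  have hr0 : 0 < r := by positivity
  have hr1 : r < 1 := by
    rw [hr]
    nth_rewrite 1 [← Real.exp_log h0]
    rw [← Real.exp_add, Real.exp_lt_one_iff, hl₀]
    linarith
  set W : ℕ → ℝ := fun j => C * Real.exp l₀ * (((j : ℝ) + 1) ^ 2 * r ^ j) with hW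
  have hW0 : ∀ j, 0 ≤ W j := fun j => by positivity
  have hWs : Summable W := by
    refine Summable.mul_left _ ?_
    have s2 := summable_pow_mul_geometric_of_norm_lt_one (R := ℝ) 2 (r := r)
      (by rwa [Real.norm_eq_abs, abs_of_pos hr0])
    have := ((summable_nat_add_iff 1).2 s2).mul_left r⁻¹
    refine this.congr fun j => ?_
    rw [pow_succ r j]; push_cast; field_simp
  have hWz : Summable fun z : ℤ => W z.natAbs := by
    refine Summable.of_nat_of_neg ?_ ?_ <;> simpa using hWs
  refine ⟨(∑' z : ℤ, W z.natAbs) + 1, l₀, ?_, by rw [hl₀]; linarith, fun d n l hl => ?_⟩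
  · have : 0 ≤ ∑' z : ℤ, W z.natAbs := tsum_nonneg fun _ => hW0 _
    linarith
  set B : ℝ := ∑' z : ℤ, W z.natAbs with hB
  have term : ∀ u : ℕ, upCount p d u 0 * Real.exp (l * (u - d - drift p d)) ≤
      upCount p d u 0 * (1 + l * (u - d - drift p d)) + l ^ 2 * W ((u : ℤ) - d).natAbs := by
    intro u
    set j := ((u : ℤ) - d).natAbs with hj
    set x : ℝ := u - d - drift p d with hx
    have hxj : |x| ≤ j + 1 := by
      have e : ((j : ℕ) : ℝ) = |(u : ℝ) - d| := by
        rw [hj, Nat.cast_natAbs]; push_cast; rfl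
      rw [e, hx]
      have := abs_sub ((u : ℝ) - d) (drift p d)
      have h3 : |drift p d| ≤ 1 := by
        rw [abs_le]; constructor <;> linarith [h.neg_half_le_drift d, h.drift_nonpos d]
      linarith
    have hq0 := h.upCount_nonneg d u 0
    have hq : upCount p d u 0 ≤ C * γ ^ j := (h.upCount_le d u).trans (hc _)
    have hy2 : (l * x) ^ 2 ≤ l ^ 2 * ((j : ℝ) + 1) ^ 2 := by
      rw [mul_pow]
      gcongr ?_ * ?_
      exact sq_le_sq' (by linarith [(abs_le.1 hxj).1]) (abs_le.1 hxj).2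
    have hye : Real.exp |l * x| ≤ Real.exp (l₀ * (j + 1)) := by
      rw [abs_mul]
      exact Real.exp_le_exp.2 (mul_le_mul hl hxj (abs_nonneg _) ((abs_nonneg _).trans hl))
    have e := exp_le_one_add_sq (l * x)
    calc upCount p d u 0 * Real.exp (l * x)
        ≤ upCount p d u 0 * (1 + l * x + (l * x) ^ 2 * Real.exp |l * x|) := by gcongr
      _ = upCount p d u 0 * (1 + l * x) +
          upCount p d u 0 * ((l * x) ^ 2 * Real.exp |l * x|) := by ring
      _ ≤ upCount p d u 0 * (1 + l * x) +
          (C * γ ^ j) * ((l ^ 2 * ((j : ℝ) + 1) ^ 2) * Real.exp (l₀ * (j + 1))) := by gcongr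
      _ = _ := by
        simp only [hW, hr]
        rw [mul_pow, ← Real.exp_nat_mul,
          show l₀ * ((j : ℝ) + 1) = j * l₀ + l₀ by ring, Real.exp_add]
        ring
  have sumW : ∀ N : ℕ, ∑ u ∈ Finset.range N, W ((u : ℤ) - d).natAbs ≤ B := by
    intro N
    have hinj : Set.InjOn (fun u : ℕ => (u : ℤ) - d) (Finset.range N) := by
      intro a _ b _ hab
      simpa using hab
    rw [← Finset.sum_image (f := fun z : ℤ => W z.natAbs) hinj]
    exact hWz.sum_le_tsum _ fun _ _ => hW0 _
  have lim := (h.tendsto_sum_upCount_mul d l).add_const (l ^ 2 * B)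
  have : ∑ u ∈ Finset.range n, upCount p d u 0 * Real.exp (l * (u - d - drift p d)) ≤
      1 + l ^ 2 * B := by
    refine ge_of_tendsto lim ?_
    filter_upwards [eventually_ge_atTop n] with N hN
    calc ∑ u ∈ Finset.range n, upCount p d u 0 * Real.exp (l * (u - d - drift p d))
        ≤ ∑ u ∈ Finset.range N, upCount p d u 0 * Real.exp (l * (u - d - drift p d)) :=
          Finset.sum_le_sum_of_subset_of_nonneg (by simpa using hN) fun u _ _ =>
            mul_nonneg (h.upCount_nonneg d u 0) (Real.exp_pos _).le
      _ ≤ ∑ u ∈ Finset.range N, (upCount p d u 0 * (1 + l * (u - d - drift p d)) +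
          l ^ 2 * W ((u : ℤ) - d).natAbs) := Finset.sum_le_sum fun u _ => term u
      _ ≤ _ := by
        rw [Finset.sum_add_distrib, ← Finset.mul_sum]
        gcongr
        exact sumW N
  refine this.trans ?_
  have e := Real.add_one_le_exp ((B + 1) * l ^ 2)
  nlinarith [sq_nonneg l]

end AttractedChain

end SelfRepelling

namespace SelfRepelling

/-- Position of the walk together with the numbers of up-exits and down-exits of every site. -/
@[ext] structure State where
  pos : ℤ
  up : ℤ → ℕ
  down : ℤ → ℕ

namespace State

/-- The initial state. -/
def start : State := ⟨0, 0, 0⟩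

/-- The state after an up-step. -/
def stepUp (σ : State) : State := ⟨σ.pos + 1, Function.update σ.up σ.pos (σ.up σ.pos + 1), σ.down⟩

/-- The state after a down-step. -/
def stepDown (σ : State) : State :=
  ⟨σ.pos - 1, σ.up, Function.update σ.down σ.pos (σ.down σ.pos + 1)⟩

/-- Difference of up-exits and down-exits of a site. -/
def diff (σ : State) (j : ℤ) : ℤ := (σ.up j : ℤ) - σ.down j

/-- Mirror image of a state. -/
def reflect (σ : State) : State := ⟨-σ.pos, fun j => σ.down (-j), fun j => σ.up (-j)⟩

/-- `Reach n σ` says that `σ` can be reached from the initial state in `n` steps. -/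
inductive Reach : ℕ → State → Prop
  | start : Reach 0 State.start
  | stepUp {n : ℕ} {σ : State} : Reach n σ → Reach (n + 1) σ.stepUp
  | stepDown {n : ℕ} {σ : State} : Reach n σ → Reach (n + 1) σ.stepDown

lemma reflect_start : start.reflect = start := by
  simp [start, reflect, Pi.zero_def]

lemma reflect_reflect (σ : State) : σ.reflect.reflect = σ := by
  simp [reflect]

lemma reflect_stepUp (σ : State) : σ.stepUp.reflect = σ.reflect.stepDown := by
  ext j
  · simp [reflect, stepUp, stepDown]; ring
  · simp [reflect, stepUp, stepDown]
  · by_cases hj : j = -σ.pos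
    · subst hj; simp [reflect, stepUp, stepDown]
    · have : -j ≠ σ.pos := by omega
      simp [reflect, stepUp, stepDown, Function.update_of_ne hj, Function.update_of_ne this]

lemma reflect_stepDown (σ : State) : σ.stepDown.reflect = σ.reflect.stepUp := by
  have := reflect_stepUp σ.reflect
  rw [reflect_reflect] at this
  rw [← this, reflect_reflect]

lemma diff_reflect (σ : State) (j : ℤ) : σ.reflect.diff j = -σ.diff (-j) := by
  simp [diff, reflect]

namespace Reach

variable {n : ℕ} {σ : State}

lemma reflect (hσ : Reach n σ) : Reach n σ.reflect := by
  induction hσ with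
  | start => rw [reflect_start]; exact .start
  | stepUp _ ih => rw [reflect_stepUp]; exact ih.stepDown
  | stepDown _ ih => rw [reflect_stepDown]; exact ih.stepUp

lemma abs_pos_le (hσ : Reach n σ) : |σ.pos| ≤ n := by
  induction hσ with
  | start => simp [State.start]
  | stepUp _ ih =>
    simp only [State.stepUp]
    push_cast
    rw [abs_le] at *; omega
  | stepDown _ ih =>
    simp only [State.stepDown]
    push_cast
    rw [abs_le] at *; omega

lemma balance (hσ : Reach n σ) (j : ℤ) : (σ.up j : ℤ) - σ.down (j + 1) =
    (if 0 ≤ j ∧ j < σ.pos then 1 else 0) - (if σ.pos ≤ j ∧ j < 0 then 1 else 0) := by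
  induction hσ with
  | start =>
    simp only [State.start, Pi.zero_apply]
    split_ifs <;> omega
  | @stepUp n σ _ ih =>
    simp only [State.stepUp]
    by_cases hj : j = σ.pos
    · subst hj
      simp only [Function.update_self]
      push_cast
      split_ifs at * <;> omega
    · rw [Function.update_of_ne hj]
      split_ifs at * <;> omega
  | @stepDown n σ _ ih =>
    simp only [State.stepDown]
    by_cases hj : j + 1 = σ.pos
    · have e : Function.update σ.down σ.pos (σ.down σ.pos + 1) (j + 1) = σ.down (j + 1) + 1 := by
        rw [hj, Function.update_self]
      rw [e]
      push_cast
      split_ifs at * <;> omega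
    · rw [Function.update_of_ne hj]
      split_ifs at * <;> omega

lemma sum_eq (hσ : Reach n σ) (S : Finset ℤ) (hS : Finset.Ioo (-n : ℤ) n ⊆ S) :
    ∑ j ∈ S, (σ.up j + σ.down j) = n := by
  induction hσ with
  | start => simp [State.start]
  | @stepUp n σ h ih =>
    have hp := abs_le.1 h.abs_pos_le
    have hmem : σ.pos ∈ S := hS (by rw [Finset.mem_Ioo]; push_cast; omega)
    have := ih (fun j hj => hS (by rw [Finset.mem_Ioo] at *; push_cast; omega))
    simp only [State.stepUp]
    rw [Finset.sum_add_distrib, Finset.sum_update_of_mem hmem,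
      Finset.sdiff_singleton_eq_erase]
    rw [Finset.sum_add_distrib, ← Finset.add_sum_erase S σ.up hmem] at this
    omega
  | @stepDown n σ h ih =>
    have hp := abs_le.1 h.abs_pos_le
    have hmem : σ.pos ∈ S := hS (by rw [Finset.mem_Ioo]; push_cast; omega)
    have := ih (fun j hj => hS (by rw [Finset.mem_Ioo] at *; push_cast; omega))
    simp only [State.stepDown]
    rw [Finset.sum_add_distrib, Finset.sum_update_of_mem hmem,
      Finset.sdiff_singleton_eq_erase]
    rw [Finset.sum_add_distrib, ← Finset.add_sum_erase S σ.down hmem] at this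
    omega

lemma add_le (hσ : Reach n σ) (j : ℤ) : σ.up j + σ.down j ≤ n := by
  rw [← hσ.sum_eq (insert j (Finset.Ioo (-n : ℤ) n)) (Finset.subset_insert _ _)]
  exact Finset.single_le_sum (f := fun j => σ.up j + σ.down j) (fun _ _ => Nat.zero_le _) (by simp)

lemma up_eq_zero (hσ : Reach n σ) (j : ℤ) (hj : σ.pos < j) (h0 : σ.down j = 0) : σ.up j = 0 := by
  induction hσ generalizing j with
  | start => rfl
  | @stepUp n σ h ih =>
    simp only [State.stepUp] at *
    rw [Function.update_of_ne (by omega)]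
    exact ih j (by omega) h0
  | @stepDown n σ h ih =>
    simp only [State.stepDown] at *
    by_cases hj' : j = σ.pos
    · rw [hj', Function.update_self] at h0; omega
    · rw [Function.update_of_ne hj'] at h0
      exact ih j (by omega) h0

end Reach

end State

open State

/-- Expectation of `f` at the state of the walk `n` steps after the state `σ`. -/
def expect (p : ℤ → ℝ) : ℕ → (State → ℝ) → State → ℝ
  | 0, f, σ => f σ
  | n + 1, f, σ => p (σ.diff σ.pos) * expect p n f σ.stepUp +
      (1 - p (σ.diff σ.pos)) * expect p n f σ.stepDown

lemma expect_succ' (p : ℤ → ℝ) (n : ℕ) (f : State → ℝ) (σ : State) :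
    expect p (n + 1) f σ = expect p n (expect p 1 f) σ := by
  induction n generalizing σ with
  | zero => rfl
  | succ n ih =>
    rw [expect, ih, ih]
    rfl

lemma expect_add (p : ℤ → ℝ) (n : ℕ) (f g : State → ℝ) (σ : State) :
    expect p n (fun τ => f τ + g τ) σ = expect p n f σ + expect p n g σ := by
  induction n generalizing σ with
  | zero => rfl
  | succ n ih => simp only [expect, ih]; ring

lemma expect_const_mul (p : ℤ → ℝ) (n : ℕ) (a : ℝ) (f : State → ℝ) (σ : State) :
    expect p n (fun τ => a * f τ) σ = a * expect p n f σ := by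
  induction n generalizing σ with
  | zero => rfl
  | succ n ih => simp only [expect, ih]; ring

lemma expect_const (p : ℤ → ℝ) (n : ℕ) (a : ℝ) (σ : State) : expect p n (fun _ => a) σ = a := by
  induction n generalizing σ with
  | zero => rfl
  | succ n ih => simp only [expect, ih]; ring

lemma expect_sum (p : ℤ → ℝ) (n : ℕ) {ι : Type*} (S : Finset ι) (f : ι → State → ℝ) (σ : State) :
    expect p n (fun τ => ∑ i ∈ S, f i τ) σ = ∑ i ∈ S, expect p n (f i) σ := by
  classical
  induction S using Finset.induction_on with
  | empty => simp [expect_const]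
  | insert a S ha ih =>
    simp only [Finset.sum_insert ha]
    rw [expect_add, ih]

namespace AttractedChain

variable {p c : ℤ → ℝ} (h : AttractedChain p c)
include h

lemma expect_mono {m n : ℕ} {f g : State → ℝ} {σ : State} (hσ : Reach m σ)
    (hfg : ∀ τ, Reach (m + n) τ → f τ ≤ g τ) : expect p n f σ ≤ expect p n g σ := by
  induction n generalizing m σ with
  | zero => exact hfg σ hσ
  | succ n ih =>
    simp only [expect]
    have e : m + (n + 1) = m + 1 + n := by ring
    rw [e] at hfg
    exact add_le_add (mul_le_mul_of_nonneg_left (ih hσ.stepUp hfg) (h.pos _).le)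
      (mul_le_mul_of_nonneg_left (ih hσ.stepDown hfg) (h.one_sub_pos _).le)

lemma expect_start_mono {n : ℕ} {f g : State → ℝ} (hfg : ∀ τ, Reach n τ → f τ ≤ g τ) :
    expect p n f start ≤ expect p n g start :=
  h.expect_mono .start (by simpa using hfg)

lemma expect_reflect (n : ℕ) (f : State → ℝ) (σ : State) :
    expect p n (fun τ => f τ.reflect) σ = expect p n f σ.reflect := by
  induction n generalizing σ with
  | zero => rfl
  | succ n ih =>
    simp only [expect]
    rw [ih, ih, reflect_stepUp, reflect_stepDown, diff_reflect, h.symm]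
    simp only [State.reflect, neg_neg]
    ring

open Classical in
/-- Probability weight of filling a site up to prescribed numbers of exits. -/
lemma expect_indicator_le (S : Finset ℤ) (k : ℤ) (hS : ∀ i ∈ S, k < i) (u d : ℤ → ℕ) (n : ℕ)
    (σ : State) :
    expect p n (fun τ => if τ.pos = k ∧ ∀ i ∈ S, τ.up i = u i ∧ τ.down i = d i then 1 else 0) σ ≤
      ∏ i ∈ S, if σ.up i ≤ u i ∧ σ.down i ≤ d i then
        upCount p (d i - σ.down i) (u i - σ.up i) (σ.diff i) else 0 := by
  have hnn : ∀ (σ : State) (i : ℤ), 0 ≤ if σ.up i ≤ u i ∧ σ.down i ≤ d i then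
      upCount p (d i - σ.down i) (u i - σ.up i) (σ.diff i) else 0 := by
    intro σ i
    split_ifs
    · exact h.upCount_nonneg _ _ _
    · exact le_rfl
  have vanish : ∀ i ∈ S, ∀ (n : ℕ) (σ : State), (d i < σ.down i ∨ (d i ≤ σ.down i ∧ i ≤ σ.pos)) →
      expect p n (fun τ => if τ.pos = k ∧ ∀ i ∈ S, τ.up i = u i ∧ τ.down i = d i
        then 1 else 0) σ = 0 := by
    intro i hi n
    induction n with
    | zero =>
      intro σ hσ
      refine if_neg fun hc => ?_
      have := (hc.2 i hi).2
      have := hS i hi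
      omega
    | succ n ih =>
      intro σ hσ
      rw [expect, ih, ih]
      · ring
      · simp only [stepDown]
        by_cases hp : i = σ.pos
        · subst hp
          rw [Function.update_self]; omega
        · rw [Function.update_of_ne hp]; omega
      · simp only [stepUp]; omega
  induction n generalizing σ with
  | zero =>
    simp only [expect]
    split_ifs with hc
    · refine (Finset.prod_eq_one fun i hi => ?_).ge
      rw [(hc.2 i hi).1, (hc.2 i hi).2]
      simp
    · exact Finset.prod_nonneg fun i _ => hnn σ i
  | succ n ih =>
    have hu : ∀ i, i ≠ σ.pos → σ.stepUp.up i = σ.up i ∧ σ.stepUp.down i = σ.down i ∧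
        σ.stepUp.diff i = σ.diff i := by
      intro i hi
      simp [stepUp, diff, Function.update_of_ne hi]
    have hd : ∀ i, i ≠ σ.pos → σ.stepDown.up i = σ.up i ∧ σ.stepDown.down i = σ.down i ∧
        σ.stepDown.diff i = σ.diff i := by
      intro i hi
      simp [stepDown, diff, Function.update_of_ne hi]
    have hp := h.pos (σ.diff σ.pos)
    have hq := h.one_sub_pos (σ.diff σ.pos)
    by_cases hmem : σ.pos ∈ S
    · rcases le_or_gt (d σ.pos) (σ.down σ.pos) with hle | hlt
      · rw [vanish _ hmem _ _ (.inr ⟨hle, le_rfl⟩)]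
        exact Finset.prod_nonneg fun i _ => hnn σ i
      · rw [expect]
        refine (add_le_add (mul_le_mul_of_nonneg_left (ih _) hp.le)
          (mul_le_mul_of_nonneg_left (ih _) hq.le)).trans (le_of_eq ?_)
        rw [← Finset.mul_prod_erase S _ hmem, ← Finset.mul_prod_erase S _ hmem,
          ← Finset.mul_prod_erase S (fun i => if σ.up i ≤ u i ∧ σ.down i ≤ d i then
          upCount p (d i - σ.down i) (u i - σ.up i) (σ.diff i) else 0) hmem]
        have e1 : ∀ i ∈ S.erase σ.pos, (if σ.stepUp.up i ≤ u i ∧ σ.stepUp.down i ≤ d i then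
            upCount p (d i - σ.stepUp.down i) (u i - σ.stepUp.up i) (σ.stepUp.diff i) else 0) =
            if σ.up i ≤ u i ∧ σ.down i ≤ d i then
            upCount p (d i - σ.down i) (u i - σ.up i) (σ.diff i) else 0 := by
          intro i hi
          obtain ⟨a, b, c⟩ := hu i (Finset.ne_of_mem_erase hi)
          rw [a, b, c]
        have e2 : ∀ i ∈ S.erase σ.pos, (if σ.stepDown.up i ≤ u i ∧ σ.stepDown.down i ≤ d i then
            upCount p (d i - σ.stepDown.down i) (u i - σ.stepDown.up i) (σ.stepDown.diff i)
            else 0) = if σ.up i ≤ u i ∧ σ.down i ≤ d i then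
            upCount p (d i - σ.down i) (u i - σ.up i) (σ.diff i) else 0 := by
          intro i hi
          obtain ⟨a, b, c⟩ := hd i (Finset.ne_of_mem_erase hi)
          rw [a, b, c]
        rw [Finset.prod_congr rfl e1, Finset.prod_congr rfl e2, ← mul_assoc, ← mul_assoc,
          ← add_mul]
        congr 1
        simp only [stepUp, stepDown, diff, Function.update_self]
        obtain ⟨b, hb⟩ : ∃ b, d σ.pos = σ.down σ.pos + (b + 1) := ⟨d σ.pos - σ.down σ.pos - 1, by omega⟩
        have b1 : d σ.pos - σ.down σ.pos = b + 1 := by omega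
        have b2 : d σ.pos - (σ.down σ.pos + 1) = b := by omega
        have b3 : σ.down σ.pos ≤ d σ.pos := hlt.le
        have b4 : σ.down σ.pos + 1 ≤ d σ.pos := hlt
        have z1 : ((σ.up σ.pos + 1 : ℕ) : ℤ) - σ.down σ.pos = σ.up σ.pos - σ.down σ.pos + 1 := by
          push_cast; ring
        have z2 : (σ.up σ.pos : ℤ) - ((σ.down σ.pos + 1 : ℕ) : ℤ) =
            σ.up σ.pos - σ.down σ.pos - 1 := by push_cast; ring
        simp only [b1, b2, b3, b4, and_true, z1, z2]
        rcases lt_trichotomy (u σ.pos) (σ.up σ.pos) with h1 | h1 | h1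
        · rw [if_neg (by omega), if_neg (by omega), if_neg (by omega)]; ring
        · rw [if_neg (by omega), if_pos (by omega), if_pos (by omega), h1, Nat.sub_self,
            upCount_succ_zero]
          ring
        · obtain ⟨a, ha⟩ : ∃ a, u σ.pos = σ.up σ.pos + (a + 1) := ⟨u σ.pos - σ.up σ.pos - 1, by omega⟩
          have a1 : u σ.pos - σ.up σ.pos = a + 1 := by omega
          have a2 : u σ.pos - (σ.up σ.pos + 1) = a := by omega
          rw [if_pos (by omega), if_pos (by omega), if_pos (by omega), a1, a2, upCount_succ_succ]
    · rw [expect]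
      have e1 := ih σ.stepUp
      have e2 := ih σ.stepDown
      have hne : ∀ i ∈ S, i ≠ σ.pos := fun i hi hi' => hmem (hi' ▸ hi)
      rw [Finset.prod_congr rfl fun i hi => by
        obtain ⟨a, b, c⟩ := hu i (hne i hi); rw [a, b, c]] at e1
      rw [Finset.prod_congr rfl fun i hi => by
        obtain ⟨a, b, c⟩ := hd i (hne i hi); rw [a, b, c]] at e2
      refine (add_le_add (mul_le_mul_of_nonneg_left e1 hp.le)
        (mul_le_mul_of_nonneg_left e2 hq.le)).trans (le_of_eq ?_)
      ring

end AttractedChain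

end SelfRepelling

namespace SelfRepelling

open State

/-- Centred number of up-exits at the `t`-th site strictly above the walker. -/
def noise (p : ℤ → ℝ) (τ : State) (t : ℕ) : ℝ :=
  τ.up (τ.pos + 1 + t) - τ.down (τ.pos + 1 + t) - drift p (τ.down (τ.pos + 1 + t))

/-- Numbers of down-exits above the walker's position `k`, as a function of the numbers of
up-exits `v`. -/
def downSeq (k : ℤ) (d₀ : ℕ) (v : ℕ → ℕ) : ℕ → ℕ
  | 0 => d₀
  | t + 1 => v t + if k + 1 + t < 0 then 1 else 0

lemma downSeq_congr (k : ℤ) (d₀ : ℕ) {v v' : ℕ → ℕ} (t : ℕ) (hv : ∀ i < t, v i = v' i) :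
    downSeq k d₀ v t = downSeq k d₀ v' t := by
  cases t with
  | zero => rfl
  | succ t => rw [downSeq, downSeq, hv t (by omega)]

lemma State.Reach.down_eq_downSeq {n : ℕ} {τ : State} (hτ : Reach n τ) (v : ℕ → ℕ) (t : ℕ)
    (hv : ∀ i < t, τ.up (τ.pos + 1 + i) = v i) :
    τ.down (τ.pos + 1 + t) = downSeq τ.pos (τ.down (τ.pos + 1)) v t := by
  cases t with
  | zero => simp [downSeq]
  | succ t =>
    have e := hτ.balance (τ.pos + 1 + t)
    rw [downSeq, ← hv t (by omega)]
    have e2 : τ.pos + 1 + ((t + 1 : ℕ) : ℤ) = τ.pos + 1 + t + 1 := by push_cast; ring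
    rw [e2]
    split_ifs at * <;> omega

namespace AttractedChain

variable {p c : ℤ → ℝ} (h : AttractedChain p c)
include h

open Classical in
lemma expect_prefix_le (k : ℤ) (d₀ : ℕ) (v : ℕ → ℕ) (n T : ℕ) :
    expect p n (fun τ => if τ.pos = k ∧ τ.down (k + 1) = d₀ ∧ ∀ t < T, τ.up (k + 1 + t) = v t
      then 1 else 0) start ≤ ∏ t ∈ Finset.range T, upCount p (downSeq k d₀ v t) (v t) 0 := by
  set S : Finset ℤ := (Finset.range T).image fun t : ℕ => k + 1 + (t : ℤ) with hS
  have e := h.expect_indicator_le S k (by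
    intro i hi
    obtain ⟨t, -, rfl⟩ := Finset.mem_image.1 hi
    omega) (fun i => v (i - k - 1).toNat) (fun i => downSeq k d₀ v (i - k - 1).toNat) n start
  have ht : ∀ t : ℕ, (k + 1 + (t : ℤ) - k - 1).toNat = t := fun t => by omega
  refine le_trans (h.expect_start_mono fun τ hτ => ?_) (e.trans (le_of_eq ?_))
  · by_cases hc : τ.pos = k ∧ τ.down (k + 1) = d₀ ∧ ∀ t < T, τ.up (k + 1 + t) = v t
    · rw [if_pos hc, if_pos]
      obtain ⟨rfl, hd, hv⟩ := hc
      refine ⟨rfl, fun i hi => ?_⟩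
      obtain ⟨t, htT, rfl⟩ := Finset.mem_image.1 hi
      rw [Finset.mem_range] at htT
      simp only [ht]
      refine ⟨hv t htT, ?_⟩
      rw [← hd]
      exact hτ.down_eq_downSeq v t fun i hi => hv i (by omega)
    · rw [if_neg hc]; split_ifs <;> norm_num
  · rw [hS, Finset.prod_image (fun a _ b _ hab => by simpa using hab)]
    refine Finset.prod_congr rfl fun t _ => ?_
    simp only [ht]
    simp [start, diff]

open Classical in
lemma expect_prefix_mul_exp_le {K l : ℝ} (hK : ∀ d n : ℕ, ∑ u ∈ Finset.range n,
    upCount p d u 0 * Real.exp (l * (u - d - drift p d)) ≤ Real.exp (K * l ^ 2))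
    (k : ℤ) (d₀ n m : ℕ) (v : ℕ → ℕ) (T : ℕ) :
    expect p n (fun τ => (if τ.pos = k ∧ τ.down (k + 1) = d₀ ∧ ∀ t < T, τ.up (k + 1 + t) = v t
      then 1 else 0) * Real.exp (l * ∑ t ∈ Finset.Ico T (T + m), noise p τ t)) start ≤
      (∏ t ∈ Finset.range T, upCount p (downSeq k d₀ v t) (v t) 0) *
        Real.exp (K * l ^ 2) ^ m := by
  induction m generalizing v T with
  | zero => simpa using h.expect_prefix_le k d₀ v n T
  | succ m ih =>
    set w : ℕ → ℝ := fun u => Real.exp (l * (u - downSeq k d₀ v T - drift p (downSeq k d₀ v T)))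
      with hw
    have hmem : ∀ (τ : State) (u : ℕ), (τ.pos = k ∧ τ.down (k + 1) = d₀ ∧
        ∀ t < T + 1, τ.up (k + 1 + t) = Function.update v T u t) ↔
        (τ.pos = k ∧ τ.down (k + 1) = d₀ ∧ ∀ t < T, τ.up (k + 1 + t) = v t) ∧
          τ.up (k + 1 + T) = u := by
      intro τ u
      constructor
      · rintro ⟨h1, h2, h3⟩
        refine ⟨⟨h1, h2, fun t ht => ?_⟩, ?_⟩
        · rw [h3 t (by omega), Function.update_of_ne (by omega)]
        · rw [h3 T (by omega), Function.update_self]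
      · rintro ⟨⟨h1, h2, h3⟩, h4⟩
        refine ⟨h1, h2, fun t ht => ?_⟩
        rcases Nat.lt_succ_iff_lt_or_eq.1 ht with ht | rfl
        · rw [h3 t ht, Function.update_of_ne (by omega)]
        · rw [h4, Function.update_self]
    calc _ ≤ expect p n (fun τ => ∑ u ∈ Finset.range (n + 1), w u *
          ((if τ.pos = k ∧ τ.down (k + 1) = d₀ ∧
            ∀ t < T + 1, τ.up (k + 1 + t) = Function.update v T u t then 1 else 0) *
          Real.exp (l * ∑ t ∈ Finset.Ico (T + 1) (T + 1 + m), noise p τ t))) start := by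
          refine h.expect_start_mono fun τ hτ => ?_
          by_cases hc : τ.pos = k ∧ τ.down (k + 1) = d₀ ∧ ∀ t < T, τ.up (k + 1 + t) = v t
          · rw [if_pos hc, one_mul]
            have hu : τ.up (k + 1 + T) ∈ Finset.range (n + 1) := by
              rw [Finset.mem_range]
              have := hτ.add_le (k + 1 + T)
              omega
            refine le_trans (le_of_eq ?_) (Finset.single_le_sum (fun u _ => ?_) hu)
            · rw [if_pos ((hmem τ _).2 ⟨hc, rfl⟩), one_mul, hw, ← Real.exp_add, ← mul_add,
                Finset.sum_eq_sum_Ico_succ_bot (by omega)]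
              have e1 : T + (m + 1) = T + 1 + m := by ring
              have e2 : noise p τ T = τ.up (k + 1 + T) - downSeq k d₀ v T -
                  drift p (downSeq k d₀ v T) := by
                obtain ⟨rfl, rfl, hv⟩ := hc
                rw [noise, hτ.down_eq_downSeq v T hv]
              rw [e1, e2]
            · refine mul_nonneg (Real.exp_pos _).le (mul_nonneg ?_ (Real.exp_pos _).le)
              split_ifs <;> norm_num
          · rw [if_neg hc, zero_mul]
            refine Finset.sum_nonneg fun u _ => mul_nonneg (Real.exp_pos _).le
              (mul_nonneg ?_ (Real.exp_pos _).le)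
            split_ifs <;> norm_num
      _ = ∑ u ∈ Finset.range (n + 1), w u * expect p n (fun τ =>
          (if τ.pos = k ∧ τ.down (k + 1) = d₀ ∧
            ∀ t < T + 1, τ.up (k + 1 + t) = Function.update v T u t then 1 else 0) *
          Real.exp (l * ∑ t ∈ Finset.Ico (T + 1) (T + 1 + m), noise p τ t)) start := by
          rw [expect_sum]
          exact Finset.sum_congr rfl fun u _ => expect_const_mul _ _ _ _ _
      _ ≤ ∑ u ∈ Finset.range (n + 1), w u * ((∏ t ∈ Finset.range (T + 1),
          upCount p (downSeq k d₀ (Function.update v T u) t) (Function.update v T u t) 0) *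
          Real.exp (K * l ^ 2) ^ m) :=
          Finset.sum_le_sum fun u _ => mul_le_mul_of_nonneg_left (ih _ _) (Real.exp_pos _).le
      _ = (∑ u ∈ Finset.range (n + 1), upCount p (downSeq k d₀ v T) u 0 * w u) *
          ((∏ t ∈ Finset.range T, upCount p (downSeq k d₀ v t) (v t) 0) *
            Real.exp (K * l ^ 2) ^ m) := by
          rw [Finset.sum_mul]
          refine Finset.sum_congr rfl fun u _ => ?_
          have e : ∀ t ∈ Finset.range T,
              upCount p (downSeq k d₀ (Function.update v T u) t) (Function.update v T u t) 0 =
              upCount p (downSeq k d₀ v t) (v t) 0 := by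
            intro t ht
            rw [Finset.mem_range] at ht
            rw [Function.update_of_ne (by omega), downSeq_congr k d₀ t fun i hi =>
              Function.update_of_ne (by omega) _ _]
          rw [Finset.prod_range_succ, Finset.prod_congr rfl e, Function.update_self,
            downSeq_congr k d₀ T fun i hi => Function.update_of_ne (by omega) _ _]
          ring
      _ ≤ Real.exp (K * l ^ 2) * ((∏ t ∈ Finset.range T, upCount p (downSeq k d₀ v t) (v t) 0) *
            Real.exp (K * l ^ 2) ^ m) := by
          refine mul_le_mul_of_nonneg_right (hK _ _) (mul_nonneg ?_ (by positivity))
          exact Finset.prod_nonneg fun _ _ => h.upCount_nonneg _ _ _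
      _ = _ := by ring

open Classical in
lemma expect_exp_noise_le {K l : ℝ} (hK : ∀ d n : ℕ, ∑ u ∈ Finset.range n,
    upCount p d u 0 * Real.exp (l * (u - d - drift p d)) ≤ Real.exp (K * l ^ 2)) (n L : ℕ) :
    expect p n (fun τ => Real.exp (l * ∑ t ∈ Finset.range L, noise p τ t)) start ≤
      (2 * n + 1) * (n + 1) * Real.exp (L * (K * l ^ 2)) := by
  calc _ ≤ expect p n (fun τ => ∑ k ∈ Finset.Icc (-n : ℤ) n, ∑ d₀ ∈ Finset.range (n + 1),
        (if τ.pos = k ∧ τ.down (k + 1) = d₀ ∧ ∀ t < (0 : ℕ), τ.up (k + 1 + t) = (0 : ℕ → ℕ) t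
      then 1 else 0) * Real.exp (l * ∑ t ∈ Finset.Ico 0 (0 + L), noise p τ t)) start := by
        refine h.expect_start_mono fun τ hτ => ?_
        have hk : τ.pos ∈ Finset.Icc (-n : ℤ) n := by
          rw [Finset.mem_Icc]; exact abs_le.1 hτ.abs_pos_le
        have hd : τ.down (τ.pos + 1) ∈ Finset.range (n + 1) := by
          rw [Finset.mem_range]
          have := hτ.add_le (τ.pos + 1)
          omega
        have nn : ∀ k : ℤ, ∀ d₀ : ℕ, 0 ≤ (if τ.pos = k ∧ τ.down (k + 1) = d₀ ∧
            ∀ t < (0 : ℕ), τ.up (k + 1 + t) = (0 : ℕ → ℕ) t then (1 : ℝ) else 0) *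
            Real.exp (l * ∑ t ∈ Finset.Ico 0 (0 + L), noise p τ t) := by
          intro k d₀
          refine mul_nonneg ?_ (Real.exp_pos _).le
          split_ifs <;> norm_num
        refine le_trans ?_ (Finset.single_le_sum
          (fun k _ => Finset.sum_nonneg fun d₀ _ => nn k d₀) hk)
        refine le_trans ?_ (Finset.single_le_sum (fun d₀ _ => nn _ d₀) hd)
        rw [if_pos ⟨rfl, rfl, fun t ht => absurd ht (by omega)⟩, one_mul, zero_add,
          Nat.Ico_zero_eq_range]
    _ = ∑ k ∈ Finset.Icc (-n : ℤ) n, ∑ d₀ ∈ Finset.range (n + 1), expect p n (fun τ =>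
        (if τ.pos = k ∧ τ.down (k + 1) = d₀ ∧ ∀ t < (0 : ℕ), τ.up (k + 1 + t) = (0 : ℕ → ℕ) t
      then 1 else 0) * Real.exp (l * ∑ t ∈ Finset.Ico 0 (0 + L), noise p τ t)) start := by
        rw [expect_sum]
        exact Finset.sum_congr rfl fun _ _ => expect_sum _ _ _ _ _
    _ ≤ ∑ k ∈ Finset.Icc (-n : ℤ) n, ∑ d₀ ∈ Finset.range (n + 1), Real.exp (L * (K * l ^ 2)) := by
        refine Finset.sum_le_sum fun k _ => Finset.sum_le_sum fun d₀ _ => ?_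
        refine (h.expect_prefix_mul_exp_le hK k d₀ n L 0 0).trans (le_of_eq ?_)
        rw [Finset.prod_range_zero, one_mul, ← Real.exp_nat_mul]
    _ = _ := by
        rw [Finset.sum_const, Finset.sum_const, Finset.card_range, Int.card_Icc]
        simp only [nsmul_eq_mul]
        have : ((n : ℤ) + 1 - -n).toNat = 2 * n + 1 := by omega
        rw [this]; push_cast; ring

open Classical in
/-- Union bound for the partial sums of the noise above the walker. -/
lemma expect_noise_bad_le {K l : ℝ} (hl : 0 ≤ l) (hK : ∀ d n : ℕ, ∑ u ∈ Finset.range n,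
    upCount p d u 0 * Real.exp (l * (u - d - drift p d)) ≤ Real.exp (K * l ^ 2))
    (hK' : ∀ d n : ℕ, ∑ u ∈ Finset.range n,
    upCount p d u 0 * Real.exp (-l * (u - d - drift p d)) ≤ Real.exp (K * (-l) ^ 2))
    (hK0 : 0 ≤ K) (n R : ℕ) (δ : ℝ) :
    expect p n (fun τ => if ∃ L ≤ R, δ < |∑ t ∈ Finset.range L, noise p τ t| then 1 else 0) start ≤
      2 * (R + 1) * ((2 * n + 1) * (n + 1)) * Real.exp (R * (K * l ^ 2) - l * δ) := by
  set E : ℝ → ℕ → State → ℝ := fun l L τ => Real.exp (l * ∑ t ∈ Finset.range L, noise p τ t) with hE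
  have hE0 : ∀ l L τ, 0 ≤ E l L τ := fun _ _ _ => (Real.exp_pos _).le
  calc _ ≤ expect p n (fun τ => ∑ L ∈ Finset.range (R + 1),
        Real.exp (-(l * δ)) * (E l L τ + E (-l) L τ)) start := by
        refine h.expect_start_mono fun τ _ => ?_
        split_ifs with hc
        · obtain ⟨L, hL, hS⟩ := hc
          refine le_trans ?_ (Finset.single_le_sum (fun L _ => mul_nonneg (Real.exp_pos _).le
            (add_nonneg (hE0 l L τ) (hE0 (-l) L τ))) (Finset.mem_range.2 (Nat.lt_succ_of_le hL)))
          rw [mul_add]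
          simp only [hE]
          rw [← Real.exp_add, ← Real.exp_add]
          rcases lt_abs.1 hS with hS | hS
          · have : 1 ≤ Real.exp (-(l * δ) + l * ∑ t ∈ Finset.range L, noise p τ t) :=
              Real.one_le_exp (by nlinarith)
            linarith [Real.exp_pos (-(l * δ) + -l * ∑ t ∈ Finset.range L, noise p τ t)]
          · have : 1 ≤ Real.exp (-(l * δ) + -l * ∑ t ∈ Finset.range L, noise p τ t) :=
              Real.one_le_exp (by nlinarith)
            linarith [Real.exp_pos (-(l * δ) + l * ∑ t ∈ Finset.range L, noise p τ t)]
        · exact Finset.sum_nonneg fun L _ => mul_nonneg (Real.exp_pos _).le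
            (add_nonneg (hE0 l L τ) (hE0 (-l) L τ))
    _ = ∑ L ∈ Finset.range (R + 1), Real.exp (-(l * δ)) *
        (expect p n (E l L) start + expect p n (E (-l) L) start) := by
        rw [expect_sum]
        refine Finset.sum_congr rfl fun L _ => ?_
        rw [expect_const_mul, expect_add]
    _ ≤ ∑ L ∈ Finset.range (R + 1), Real.exp (-(l * δ)) *
        (2 * ((2 * n + 1) * (n + 1) * Real.exp (R * (K * l ^ 2)))) := by
        refine Finset.sum_le_sum fun L hL => mul_le_mul_of_nonneg_left ?_ (Real.exp_pos _).le
        have e1 := h.expect_exp_noise_le hK n L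
        have e2 := h.expect_exp_noise_le hK' n L
        rw [neg_sq] at e2
        have hLR : (L : ℝ) ≤ R := by
          exact_mod_cast Nat.lt_succ_iff.1 (Finset.mem_range.1 hL)
        have e3 : (2 * (n : ℝ) + 1) * (n + 1) * Real.exp (L * (K * l ^ 2)) ≤
            (2 * (n : ℝ) + 1) * (n + 1) * Real.exp (R * (K * l ^ 2)) := by
          gcongr
        linarith
    _ = _ := by
        rw [Finset.sum_const, Finset.card_range, nsmul_eq_mul, sub_eq_add_neg, Real.exp_add]
        push_cast; ring

end AttractedChain

end SelfRepelling

namespace SelfRepelling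

/-- Data for a noisy recursion `d (t + 1) = d t + a (d t) + e t + 1_{t < T}` with nonpositive
drift `a` which tends to `-1/2`, and noise whose first `R` partial sums are at most `δ`. -/
structure NoisyFall (a : ℕ → ℝ) (d : ℕ → ℕ) (e : ℕ → ℝ) (T R : ℕ) (δ ε : ℝ) (K : ℕ) : Prop where
  step : ∀ t, (d (t + 1) : ℝ) = d t + a (d t) + e t + if t < T then 1 else 0
  noise_le : ∀ L ≤ R, |∑ t ∈ Finset.range L, e t| ≤ δ
  drift_nonpos : ∀ x, a x ≤ 0
  neg_half_le : ∀ x, -(1 / 2) ≤ a x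
  drift_le : ∀ x, K ≤ x → a x ≤ -(1 / 2) + ε
  eps_nonneg : 0 ≤ ε

namespace NoisyFall

variable {a : ℕ → ℝ} {d : ℕ → ℕ} {e : ℕ → ℝ} {T R : ℕ} {δ ε : ℝ} {K : ℕ}
  (H : NoisyFall a d e T R δ ε K)
include H

omit H in
lemma min_succ (t T : ℕ) : ((min (t + 1) T : ℕ) : ℝ) = (min t T : ℕ) + if t < T then 1 else 0 := by
  split_ifs with ht
  · rw [min_eq_left (by omega), min_eq_left (by omega)]; push_cast; ring
  · rw [min_eq_right (by omega), min_eq_right (by omega)]; ring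

lemma le_apply {L : ℕ} (hL : L ≤ R) : (d 0 : ℝ) + (min L T : ℕ) - L / 2 - δ ≤ d L := by
  have key : ∀ L : ℕ, (d 0 : ℝ) + (min L T : ℕ) - L / 2 + ∑ t ∈ Finset.range L, e t ≤ d L := by
    intro L
    induction L with
    | zero => simp
    | succ L ih =>
      rw [H.step, min_succ, Finset.sum_range_succ]
      have := H.neg_half_le (d L)
      rw [Nat.cast_succ]
      linarith
  have := (abs_le.1 (H.noise_le L hL)).1
  linarith [key L]

lemma apply_le_add {L : ℕ} (hL : L ≤ R) : (d L : ℝ) ≤ d 0 + (min L T : ℕ) + δ := by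
  have key : ∀ L : ℕ, (d L : ℝ) ≤ (d 0 : ℝ) + (min L T : ℕ) + ∑ t ∈ Finset.range L, e t := by
    intro L
    induction L with
    | zero => simp
    | succ L ih =>
      rw [H.step, min_succ, Finset.sum_range_succ]
      have := H.drift_nonpos (d L)
      linarith
  have := (abs_le.1 (H.noise_le L hL)).2
  linarith [key L]

lemma apply_le {L : ℕ} (hL : L ≤ R) :
    (d L : ℝ) ≤ max ((d 0 : ℝ) + (min L T : ℕ) - L / 2) 0 + (K + 1 + ε * R + 2 * δ) := by
  have key : ∀ L : ℕ, ∃ t ≤ L, (t = 0 ∨ d t ≤ K) ∧ (d L : ℝ) ≤ d t + ((min L T : ℕ) -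
      (min t T : ℕ)) - (L - t) / 2 + ε * (L - t) + (∑ t ∈ Finset.range L, e t -
      ∑ i ∈ Finset.range t, e i) + 1 / 2 := by
    intro L
    induction L with
    | zero => exact ⟨0, le_rfl, .inl rfl, by simp⟩
    | succ L ih =>
      rcases le_or_gt K (d L) with hK | hK
      · obtain ⟨t, htL, ht, hle⟩ := ih
        refine ⟨t, by omega, ht, ?_⟩
        rw [H.step, min_succ, Finset.sum_range_succ]
        have := H.drift_le _ hK
        rw [Nat.cast_succ]
        linarith
      · refine ⟨L, by omega, .inr hK.le, ?_⟩
        rw [H.step, min_succ, Finset.sum_range_succ]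
        have := H.drift_nonpos (d L)
        have := H.eps_nonneg
        rw [Nat.cast_succ]
        linarith
  obtain ⟨t, htL, ht, hle⟩ := key L
  have hE1 := abs_le.1 (H.noise_le L hL)
  have hE2 := abs_le.1 (H.noise_le t (htL.trans hL))
  have hLt : (t : ℝ) ≤ L := by exact_mod_cast htL
  have hLR : (L : ℝ) ≤ R := by exact_mod_cast hL
  have ht0 : (0 : ℝ) ≤ t := by positivity
  have hd0 : (0 : ℝ) ≤ d 0 := by positivity
  have hK0 : (0 : ℝ) ≤ K := by positivity
  have hε : ε * (L - t) ≤ ε * R := mul_le_mul_of_nonneg_left (by linarith) H.eps_nonneg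
  have hm1 := le_max_left ((d 0 : ℝ) + (min L T : ℕ) - L / 2) 0
  have hm2 := le_max_right ((d 0 : ℝ) + (min L T : ℕ) - L / 2) 0
  rcases ht with rfl | ht
  · simp only [Finset.range_zero, Finset.sum_empty, zero_le, inf_of_le_left, CharP.cast_eq_zero,
      sub_zero] at hle hε
    linarith
  · have htK : (d t : ℝ) ≤ K := by exact_mod_cast ht
    rcases le_total L T with h1 | h1
    · rw [min_eq_left h1] at *
      rw [min_eq_left (htL.trans h1)] at hle
      linarith
    · rcases le_total t T with h2 | h2
      · rw [min_eq_right h1] at *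
        rw [min_eq_left h2] at hle
        linarith
      · rw [min_eq_right h1] at *
        rw [min_eq_right h2] at hle
        linarith

lemma abs_sub_le {L : ℕ} (hL : L ≤ R) :
    |(d L : ℝ) - max ((d 0 : ℝ) + (min L T : ℕ) - L / 2) 0| ≤ K + 1 + ε * R + 2 * δ := by
  have h1 := H.le_apply hL
  have h2 := H.apply_le hL
  have hδ : 0 ≤ δ := (abs_nonneg _).trans (H.noise_le 0 (Nat.zero_le _))
  have h3 : 0 ≤ ε * R := mul_nonneg H.eps_nonneg (Nat.cast_nonneg _)
  have h4 : (0 : ℝ) ≤ K := Nat.cast_nonneg _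
  have h5 : (0 : ℝ) ≤ d L := Nat.cast_nonneg _
  rw [abs_le]
  refine ⟨?_, by linarith⟩
  rcases max_cases ((d 0 : ℝ) + (min L T : ℕ) - L / 2) 0 with ⟨h, _⟩ | ⟨h, _⟩ <;> rw [h] <;>
    linarith

/-- After the rising phase the sequence reaches `0` within a time proportional to its height. -/
lemma exists_eq_zero {θ : ℝ} (hθ : 0 < θ) (ha : ∀ x, x ≠ 0 → a x ≤ -θ)
    (hR : T + ((d 0 : ℝ) + T + 3 * δ) / θ < R) : ∃ t, T ≤ t ∧ t ≤ R ∧ d t = 0 := by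
  by_contra! hc
  have hδ : 0 ≤ δ := (abs_nonneg _).trans (H.noise_le 0 (Nat.zero_le _))
  have hTR : T ≤ R := by
    have : (0 : ℝ) ≤ ((d 0 : ℝ) + T + 3 * δ) / θ := by positivity
    exact_mod_cast (by linarith : (T : ℝ) ≤ R)
  have key : ∀ m : ℕ, T + m ≤ R → (d (T + m) : ℝ) ≤ d T - θ * m +
      (∑ t ∈ Finset.range (T + m), e t - ∑ t ∈ Finset.range T, e t) := by
    intro m
    induction m with
    | zero => simp
    | succ m ih =>
      intro hm
      have := ih (by omega)
      rw [← add_assoc, H.step, if_neg (by omega), Finset.sum_range_succ]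
      have := ha _ (hc (T + m) (by omega) (by omega))
      push_cast
      linarith
  have h1 := key (R - T) (by omega)
  rw [Nat.add_sub_cancel' hTR, Nat.cast_sub hTR] at h1
  have h2 := abs_le.1 (H.noise_le R le_rfl)
  have h3 := abs_le.1 (H.noise_le T hTR)
  have h4 := H.apply_le_add hTR
  rw [min_self] at h4
  have h5 : (0 : ℝ) ≤ d R := Nat.cast_nonneg _
  have h6 : ((d 0 : ℝ) + T + 3 * δ) / θ < R - T := by linarith
  rw [div_lt_iff₀ hθ] at h6
  nlinarith

end NoisyFall

open State

/-- The first `R` partial sums of the noise above the walker are at most `δ`. -/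
def SmallNoise (p : ℤ → ℝ) (R : ℕ) (δ : ℝ) (τ : State) : Prop :=
  ∀ L ≤ R, |∑ t ∈ Finset.range L, noise p τ t| ≤ δ

/-- Both sides of the walker have small noise, and so does its current site. -/
structure GoodState (p : ℤ → ℝ) (R : ℕ) (δ : ℝ) (τ : State) : Prop where
  right : SmallNoise p R δ τ
  left : SmallNoise p R δ τ.reflect
  diff_le : |(τ.up τ.pos : ℝ) - τ.down τ.pos| ≤ δ + 1

lemma GoodState.reflect {p : ℤ → ℝ} {R : ℕ} {δ : ℝ} {τ : State} (hτ : GoodState p R δ τ) :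
    GoodState p R δ τ.reflect := by
  refine ⟨hτ.left, ?_, ?_⟩
  · rw [reflect_reflect]; exact hτ.right
  · have := hτ.diff_le
    rw [abs_sub_comm] at this
    simpa [State.reflect] using this

lemma State.Reach.down_succ {n : ℕ} {τ : State} (hτ : Reach n τ) (t : ℕ) :
    τ.down (τ.pos + 1 + ((t + 1 : ℕ) : ℤ)) =
      τ.up (τ.pos + 1 + t) + if t < (-τ.pos - 1).toNat then 1 else 0 := by
  have e := hτ.balance (τ.pos + 1 + t)
  have e2 : τ.pos + 1 + ((t + 1 : ℕ) : ℤ) = τ.pos + 1 + t + 1 := by push_cast; ring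
  rw [e2]
  split_ifs at * <;> omega

/-- Once the number of down-exits vanishes away from the origin, everything further vanishes. -/
lemma State.Reach.eq_zero_of_down_eq_zero {n : ℕ} {τ : State} (hτ : Reach n τ) {t : ℕ}
    (ht : (-τ.pos - 1).toNat ≤ t) (h0 : τ.down (τ.pos + 1 + t) = 0) {t' : ℕ} (htt : t ≤ t') :
    τ.up (τ.pos + 1 + t') = 0 ∧ τ.down (τ.pos + 1 + t') = 0 := by
  have hd : τ.down (τ.pos + 1 + t') = 0 := by
    induction t', htt using Nat.le_induction with
    | base => exact h0
    | succ m hm ih => rw [hτ.down_succ, if_neg (by omega), hτ.up_eq_zero _ (by omega) ih]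
  exact ⟨hτ.up_eq_zero _ (by omega) hd, hd⟩

lemma AttractedChain.noisyFall {p c : ℤ → ℝ} (h : AttractedChain p c) {n : ℕ} {τ : State}
    (hτ : Reach n τ) {R : ℕ} {δ ε : ℝ} {K : ℕ} (hn : SmallNoise p R δ τ)
    (hK : ∀ x, K ≤ x → drift p x ≤ -(1 / 2) + ε) (hε : 0 ≤ ε) :
    NoisyFall (drift p) (fun t => τ.down (τ.pos + 1 + t)) (noise p τ) (-τ.pos - 1).toNat R δ ε K where
  step t := by
    rw [hτ.down_succ, noise]; push_cast; ring
  noise_le := hn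
  drift_nonpos := h.drift_nonpos
  neg_half_le := h.neg_half_le_drift
  drift_le := hK
  eps_nonneg := hε

lemma sum_tent (ρ : ℕ) (S : Finset ℤ) (hS : Finset.Icc (-ρ : ℤ) ρ ⊆ S) :
    ∑ j ∈ S, max ((ρ : ℝ) - |(j : ℝ)|) 0 = (ρ : ℝ) ^ 2 := by
  have hout : ∀ (ρ : ℕ) (j : ℤ), j ∉ Finset.Icc (-ρ : ℤ) ρ → (ρ : ℝ) ≤ |(j : ℝ)| := by
    intro ρ j hj
    rw [Finset.mem_Icc, ← abs_le, not_le] at hj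
    exact_mod_cast hj.le
  rw [← Finset.sum_subset hS fun j _ hj => max_eq_right (by linarith [hout ρ j hj])]
  clear hS S
  induction ρ with
  | zero => simp
  | succ ρ ih =>
    have hsub : Finset.Icc (-ρ : ℤ) ρ ⊆ Finset.Icc (-(ρ + 1 : ℕ) : ℤ) (ρ + 1 : ℕ) := by
      apply Finset.Icc_subset_Icc <;> push_cast <;> omega
    rw [← Finset.sum_subset hsub fun j _ hj => max_eq_right ?_]
    · have : ∀ j ∈ Finset.Icc (-ρ : ℤ) ρ, max (((ρ + 1 : ℕ) : ℝ) - |(j : ℝ)|) 0 =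
          max ((ρ : ℝ) - |(j : ℝ)|) 0 + 1 := by
        intro j hj
        rw [Finset.mem_Icc, ← abs_le] at hj
        have hj' : |(j : ℝ)| ≤ ρ := by exact_mod_cast hj
        push_cast
        rw [max_eq_left (by linarith), max_eq_left (by linarith)]; ring
      rw [Finset.sum_congr rfl this, Finset.sum_add_distrib, ih, Finset.sum_const, Int.card_Icc]
      have : ((ρ : ℤ) + 1 - -ρ).toNat = 2 * ρ + 1 := by omega
      rw [this]; push_cast; ring
    · rw [Finset.mem_Icc, ← abs_le, not_le] at hj
      have : ((ρ + 1 : ℕ) : ℤ) ≤ |j| := by push_cast; omega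
      have : ((ρ + 1 : ℕ) : ℝ) ≤ |(j : ℝ)| := by exact_mod_cast this
      linarith

end SelfRepelling

namespace SelfRepelling

open State

lemma State.Reach.sum_range_down_le {n : ℕ} {τ : State} (hτ : Reach n τ) (k : ℤ) (I : Finset ℕ) :
    ∑ t ∈ I, τ.down (k + t) ≤ n := by
  have hinj : Set.InjOn (fun t : ℕ => k + t) I := fun a _ b _ hab => by
    simpa using hab
  rw [← Finset.sum_image (f := τ.down) hinj, ← hτ.sum_eq (I.image (fun t : ℕ => k + t) ∪
    Finset.Ioo (-n : ℤ) n) Finset.subset_union_right]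
  exact (Finset.sum_le_sum_of_subset Finset.subset_union_left).trans
    (Finset.sum_le_sum fun _ _ => Nat.le_add_left _ _)

lemma abs_max_zero_sub_le {a b e : ℝ} (h : |a - b| ≤ e) : |max a 0 - max b 0| ≤ e :=
  (abs_max_sub_max_le_abs a b 0).trans h

/-- Local times of a good state follow the tent profile with slope `1`. -/
lemma AttractedChain.profile {p c : ℤ → ℝ} (h : AttractedChain p c) {n : ℕ} {τ : State}
    (hτ : Reach n τ) {R : ℕ} {δ ε : ℝ} {K : ℕ} (hg : GoodState p R δ τ)
    (hK : ∀ x, K ≤ x → drift p x ≤ -(1 / 2) + ε) (hε : 0 ≤ ε) {y r : ℕ} (hy : τ.pos = y)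
    (hr : τ.down (τ.pos + 1) = r) (hzr : ∃ t ≤ R, τ.down (y + 1 + t) = 0)
    (hzl : ∃ t, y - 1 ≤ t ∧ t ≤ R ∧ τ.up (y - 1 - t) = 0) (hR : 2 * r + 2 * y ≤ R) (j : ℤ) :
    |((τ.up j + τ.down j : ℕ) : ℝ) - max (((2 * r + y : ℕ) : ℝ) - |(j : ℝ)|) 0| ≤
      2 * (K + 1 + ε * R + 2 * δ) + 2 * δ + 10 ∧
    (R < |j - y| → τ.up j + τ.down j = 0) := by
  have hδ : 0 ≤ δ := (abs_nonneg _).trans (hg.right 0 (Nat.zero_le _))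
  have hεR : 0 ≤ ε * R := mul_nonneg hε (Nat.cast_nonneg _)
  have hK0 : (0 : ℝ) ≤ K := Nat.cast_nonneg _
  have hup : τ.up y = r := by
    have := hτ.balance y
    rw [← hr, hy]
    rw [hy] at this
    split_ifs at this <;> omega
  have hupp : τ.up (y - 1) = τ.down y + if 1 ≤ y then 1 else 0 := by
    have := hτ.balance (y - 1)
    rw [hy, sub_add_cancel] at this
    split_ifs at * <;> omega
  have hdiff := hg.diff_le
  rw [hy, hup] at hdiff
  have hfar : ∀ t : ℕ, 2 * r + 2 * y ≤ t →
      max (((2 * r + y : ℕ) : ℝ) - |((y + 1 + t : ℤ) : ℝ)|) 0 = 0 ∧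
      max (((2 * r + y : ℕ) : ℝ) - |((y - 1 - t : ℤ) : ℝ)|) 0 = 0 := by
    intro t ht
    constructor
    · apply max_eq_right
      have : ((2 * r + y : ℕ) : ℤ) ≤ |(y + 1 + t : ℤ)| := by
        rw [le_abs]; left; push_cast; omega
      have : ((2 * r + y : ℕ) : ℝ) ≤ |((y + 1 + t : ℤ) : ℝ)| := by exact_mod_cast this
      linarith
    · apply max_eq_right
      have : ((2 * r + y : ℕ) : ℤ) ≤ |(y - 1 - t : ℤ)| := by
        rw [le_abs]; right; push_cast; omega
      have : ((2 * r + y : ℕ) : ℝ) ≤ |((y - 1 - t : ℤ) : ℝ)| := by exact_mod_cast this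
      linarith
  rcases lt_trichotomy j y with hj | hj | hj
  · obtain ⟨t, rfl⟩ : ∃ t : ℕ, j = y - 1 - t := ⟨(y - 1 - j).toNat, by omega⟩
    have hpos : τ.reflect.pos = -y := by simp [State.reflect, hy]
    have hT : (-τ.reflect.pos - 1).toNat = y - 1 := by rw [hpos]; omega
    have eup : ∀ t : ℕ, τ.reflect.up (τ.reflect.pos + 1 + t) = τ.down (y - 1 - t) := by
      intro t; rw [hpos]; simp only [State.reflect]; congr 1; ring
    have edown : ∀ t : ℕ, τ.reflect.down (τ.reflect.pos + 1 + t) = τ.up (y - 1 - t) := by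
      intro t; rw [hpos]; simp only [State.reflect]; congr 1; ring
    have hzero : ∀ t : ℕ, R ≤ t → τ.up (y - 1 - t) + τ.down (y - 1 - t) = 0 := by
      intro t ht
      obtain ⟨t₀, h1, h2, h3⟩ := hzl
      have := hτ.reflect.eq_zero_of_down_eq_zero (t := t₀) (t' := t) (by rw [hT]; exact h1)
        (by rw [edown, h3]) (by omega)
      rw [eup, edown] at this
      omega
    refine ⟨?_, fun hlt => hzero t ?_⟩
    · rcases le_or_gt R t with hRt | hRt
      · rw [hzero t hRt, (hfar t (by omega)).2]
        simp only [Nat.cast_zero, sub_zero, abs_zero]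
        positivity
      · have H := h.noisyFall hτ.reflect hg.left hK hε
        have h1 := H.abs_sub_le (L := t) hRt.le
        have h2 := H.abs_sub_le (L := t + 1) hRt
        have hds := hτ.reflect.down_succ t
        rw [hT] at h1 h2 hds
        rw [eup] at hds
        simp only [hds] at h2
        simp only [edown] at h1 h2
        have e0 : τ.up (y - 1 - ((0 : ℕ) : ℤ)) = τ.down y + if 1 ≤ y then 1 else 0 := by
          rw [← hupp]; simp
        simp only [e0] at h1 h2
        set d0 : ℝ := ((τ.down y + if 1 ≤ y then 1 else 0 : ℕ) : ℝ) with hd0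
        have hd0r : |d0 - r| ≤ δ + 2 := by
          have : d0 = τ.down y + if 1 ≤ y then (1 : ℝ) else 0 := by rw [hd0]; push_cast; rfl
          rw [abs_le] at *
          split_ifs at this <;> constructor <;> linarith
        rw [abs_le] at hd0r
        have h3 : |max (d0 + (min t (y - 1) : ℕ) - t / 2) 0 -
            max (((2 * r + y : ℕ) : ℝ) / 2 - |((y - 1 - t : ℤ) : ℝ)| / 2) 0| ≤ δ + 2 + 1 := by
          apply abs_max_zero_sub_le
          rcases le_total t (y - 1) with h' | h'
          · rw [min_eq_left h']
            rcases Nat.eq_zero_or_pos y with rfl | hy0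
            · obtain rfl : t = 0 := by omega
              rw [abs_le]; push_cast
              simp only [abs_neg, abs_one]
              constructor <;> linarith
            · rw [abs_of_nonneg (a := ((y - 1 - t : ℤ) : ℝ)) (by exact_mod_cast (by omega : (0 : ℤ) ≤ y - 1 - t)), abs_le]
              push_cast
              constructor <;> linarith
          · rw [min_eq_right h', abs_of_nonpos (a := ((y - 1 - t : ℤ) : ℝ))
              (by exact_mod_cast (by omega : (y - 1 - t : ℤ) ≤ 0)), abs_le]
            rcases Nat.eq_zero_or_pos y with rfl | hy0
            · push_cast
              constructor <;> linarith
            · rw [Nat.cast_sub hy0]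
              push_cast
              constructor <;> linarith
        have h4 : |max (d0 + (min (t + 1) (y - 1) : ℕ) - ((t + 1 : ℕ) : ℝ) / 2) 0 -
            max (d0 + (min t (y - 1) : ℕ) - t / 2) 0| ≤ 1 / 2 := by
          apply abs_max_zero_sub_le
          rw [NoisyFall.min_succ, Nat.cast_succ, abs_le]
          split_ifs <;> constructor <;> linarith
        have h5 : max (((2 * r + y : ℕ) : ℝ) - |((y - 1 - t : ℤ) : ℝ)|) 0 = 2 *
            max (((2 * r + y : ℕ) : ℝ) / 2 - |((y - 1 - t : ℤ) : ℝ)| / 2) 0 := by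
          rw [mul_max_of_nonneg _ _ (by norm_num)]; congr 1 <;> ring
        have h6 : |(((τ.down (y - 1 - t) + if t < y - 1 then 1 else 0 : ℕ)) : ℝ) -
            τ.down (y - 1 - t)| ≤ 1 := by
          rw [abs_le]; push_cast; split_ifs <;> constructor <;> linarith
        rw [h5, Nat.cast_add]
        rw [abs_le] at *
        constructor <;> linarith
    · rw [lt_abs] at hlt; omega
  · subst hj
    refine ⟨?_, fun hlt => ?_⟩
    · have : ((2 * r + y : ℕ) : ℝ) - |((y : ℤ) : ℝ)| = 2 * r := by
        rw [abs_of_nonneg (by positivity)]; push_cast; ring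
      rw [this, max_eq_left (by positivity), hup, Nat.cast_add]
      rw [abs_le] at *
      constructor <;> linarith
    · rw [sub_self, abs_zero] at hlt; omega
  · obtain ⟨t, rfl⟩ : ∃ t : ℕ, j = y + 1 + t := ⟨(j - y - 1).toNat, by omega⟩
    have hT : (-τ.pos - 1).toNat = 0 := by rw [hy]; omega
    have hzero : ∀ t : ℕ, R ≤ t → τ.up (y + 1 + t) + τ.down (y + 1 + t) = 0 := by
      intro t ht
      obtain ⟨t₀, h2, h3⟩ := hzr
      have := hτ.eq_zero_of_down_eq_zero (t := t₀) (t' := t) (by rw [hT]; omega)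
        (by rw [hy, h3]) (by omega)
      rw [hy] at this
      omega
    refine ⟨?_, fun hlt => hzero t ?_⟩
    · rcases le_or_gt R t with hRt | hRt
      · rw [hzero t hRt, (hfar t (by omega)).1]
        simp only [Nat.cast_zero, sub_zero, abs_zero]
        positivity
      · have H := h.noisyFall hτ hg.right hK hε
        have h1 := H.abs_sub_le (L := t) hRt.le
        have h2 := H.abs_sub_le (L := t + 1) hRt
        have hds := hτ.down_succ t
        rw [hT] at h1 h2 hds
        rw [if_neg (Nat.not_lt_zero _), add_zero] at hds
        simp only [hds] at h2
        simp only [Nat.min_zero, Nat.cast_zero, add_zero, hr] at h1 h2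
        rw [hy] at h1 h2
        have h3 : |max ((r : ℝ) - t / 2) 0 -
            max (((2 * r + y : ℕ) : ℝ) / 2 - |((y + 1 + t : ℤ) : ℝ)| / 2) 0| ≤ 1 := by
          apply abs_max_zero_sub_le
          rw [abs_of_nonneg (a := ((y + 1 + t : ℤ) : ℝ)) (by positivity), abs_le]
          push_cast
          constructor <;> linarith
        have h4 : |max ((r : ℝ) - ((t + 1 : ℕ) : ℝ) / 2) 0 - max ((r : ℝ) - t / 2) 0| ≤ 1 / 2 := by
          apply abs_max_zero_sub_le
          rw [Nat.cast_succ, abs_le]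
          constructor <;> linarith
        have h5 : max (((2 * r + y : ℕ) : ℝ) - |((y + 1 + t : ℤ) : ℝ)|) 0 = 2 *
            max (((2 * r + y : ℕ) : ℝ) / 2 - |((y + 1 + t : ℤ) : ℝ)| / 2) 0 := by
          rw [mul_max_of_nonneg _ _ (by norm_num)]; congr 1 <;> ring
        rw [h5, Nat.cast_add]
        rw [abs_le] at *
        constructor <;> linarith
    · rw [lt_abs] at hlt; omega

end SelfRepelling

namespace SelfRepelling

open State

namespace AttractedChain

variable {p c : ℤ → ℝ} (h : AttractedChain p c)
include h

/-- The height of the local time profile at the walker is at most of the order of the square root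
of the elapsed time. -/
lemma down_le_of_goodState {n N : ℕ} {τ : State} (hτ : Reach n τ) {R : ℕ} {δ ε : ℝ} {K : ℕ}
    (hg : GoodState p R δ τ) (hK : ∀ x, K ≤ x → drift p x ≤ -(1 / 2) + ε) (hε : 0 ≤ ε)
    (hpos : 0 ≤ τ.pos) (hN : 0 < N) (hn : n ≤ N ^ 2) (hδ : δ ≤ N) (hR : N ≤ R) :
    τ.down (τ.pos + 1) ≤ 3 * N := by
  by_contra! hc
  have H := h.noisyFall hτ hg.right hK hε
  have hT : (-τ.pos - 1).toNat = 0 := by omega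
  rw [hT] at H
  have hc' : ((3 * N : ℕ) : ℝ) < τ.down (τ.pos + 1) := by exact_mod_cast hc
  push_cast at hc'
  have hterm : ∀ t ∈ Finset.range N, (3 * N / 2 : ℝ) ≤ τ.down (τ.pos + 1 + t) := by
    intro t ht
    rw [Finset.mem_range] at ht
    have h1 := H.le_apply (L := t) (by omega)
    have h2 : (t : ℝ) ≤ N := by exact_mod_cast ht.le
    simp only [Nat.min_zero, Nat.cast_zero, add_zero] at h1
    linarith
  have hsum := Finset.card_nsmul_le_sum _ _ _ hterm
  rw [Finset.card_range, nsmul_eq_mul] at hsum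
  have h3 : (∑ t ∈ Finset.range N, (τ.down (τ.pos + 1 + t) : ℝ)) ≤ N ^ 2 := by
    exact_mod_cast (hτ.sum_range_down_le _ _).trans hn
  have : (0 : ℝ) < N := by exact_mod_cast hN
  nlinarith

/-- The distance of the walker from the origin is at most of the order of the square root of the
elapsed time. -/
lemma pos_le_of_goodState {n N : ℕ} {τ : State} (hτ : Reach n τ) {R : ℕ} {δ ε : ℝ} {K : ℕ}
    (hg : GoodState p R δ τ) (hK : ∀ x, K ≤ x → drift p x ≤ -(1 / 2) + ε) (hε : 0 ≤ ε)
    (hN : 0 < N) (hn : n ≤ N ^ 2) (hδ : δ ≤ N) (hR : 8 * N ≤ R) :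
    τ.pos ≤ 8 * N := by
  by_contra! hc
  have H := h.noisyFall hτ.reflect hg.left hK hε
  have hterm : ∀ t ∈ Finset.Ico (4 * N) (8 * N),
      (N : ℝ) ≤ τ.reflect.down (τ.reflect.pos + 1 + t) := by
    intro t ht
    rw [Finset.mem_Ico] at ht
    have h1 := H.le_apply (L := t) (by omega)
    have h2 : ((4 * N : ℕ) : ℝ) ≤ t := by exact_mod_cast ht.1
    have h3 : min t (-τ.reflect.pos - 1).toNat = t := by
      apply min_eq_left
      simp only [State.reflect]
      omega
    rw [h3] at h1
    push_cast at h2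
    have := Nat.cast_nonneg (α := ℝ) (τ.reflect.down (τ.reflect.pos + 1 + 0))
    simp only [Nat.cast_zero] at h1
    linarith
  have hsum := Finset.card_nsmul_le_sum _ _ _ hterm
  rw [Nat.card_Ico, nsmul_eq_mul, show 8 * N - 4 * N = 4 * N by omega] at hsum
  have h3 : (∑ t ∈ Finset.Ico (4 * N) (8 * N),
      (τ.reflect.down (τ.reflect.pos + 1 + t) : ℝ)) ≤ N ^ 2 := by
    exact_mod_cast (hτ.reflect.sum_range_down_le _ _).trans hn
  have : (0 : ℝ) < N := by exact_mod_cast hN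
  push_cast at hsum
  nlinarith

/-- The local times of a good state are close to the tent of area `n` centred at the origin. -/
lemma abs_localTime_sub_le_of_nonneg {n N R c' : ℕ} {τ : State} (hτ : Reach n τ) {δ ε θ : ℝ}
    {K : ℕ} (hg : GoodState p R δ τ) (hK : ∀ x, K ≤ x → drift p x ≤ -(1 / 2) + ε) (hε : 0 ≤ ε)
    (hθ : 0 < θ) (hθ' : ∀ d, d ≠ 0 → drift p d ≤ -θ) (hN : 0 < N) (hn : n ≤ N ^ 2) (hδ : δ ≤ N)
    (hc : 17 / θ + 30 ≤ c') (hR : R = c' * N) (hpos : 0 ≤ τ.pos) (j : ℤ) :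
    |((τ.up j + τ.down j : ℕ) : ℝ) - max (√n - |(j : ℝ)|) 0| ≤
      (2 * (K + 1 + ε * R + 2 * δ) + 2 * δ + 10) +
      √((2 * R + 3) * (2 * (K + 1 + ε * R + 2 * δ) + 2 * δ + 10)) := by
  have hδ0 : 0 ≤ δ := (abs_nonneg _).trans (hg.right 0 (Nat.zero_le _))
  have hN' : (1 : ℝ) ≤ N := by exact_mod_cast hN
  have hRN : 17 * N / θ + 30 * N ≤ (R : ℝ) := by
    rw [hR, Nat.cast_mul]
    refine le_trans (le_of_eq ?_) (mul_le_mul_of_nonneg_right hc (Nat.cast_nonneg N))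
    ring
  have hR30 : 30 * N ≤ R := by
    have : (0 : ℝ) ≤ 17 * N / θ := by positivity
    have : ((30 * N : ℕ) : ℝ) ≤ R := by push_cast; linarith
    exact_mod_cast this
  obtain ⟨y, hy⟩ := Int.eq_ofNat_of_zero_le hpos
  set r := τ.down (τ.pos + 1) with hr
  have hr3 := h.down_le_of_goodState hτ hg hK hε hpos hN hn hδ (by omega)
  have hy8 := h.pos_le_of_goodState hτ hg hK hε hN hn hδ (by omega)
  rw [← hr] at hr3
  have hy8' : y ≤ 8 * N := by omega
  have hr3' : (r : ℝ) ≤ 3 * N := by exact_mod_cast hr3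
  have hy8r : (y : ℝ) ≤ 8 * N := by exact_mod_cast hy8'
  have hzr : ∃ t ≤ R, τ.down (y + 1 + t) = 0 := by
    obtain ⟨t, _, ht, h0⟩ := (h.noisyFall hτ hg.right hK hε).exists_eq_zero hθ hθ' (by
      have hT : (-τ.pos - 1).toNat = 0 := by omega
      simp only [hT, Nat.cast_zero, add_zero, zero_add]
      rw [← hr]
      have : (r + 3 * δ) / θ ≤ 17 * N / θ := by gcongr; linarith
      linarith)
    exact ⟨t, ht, by rw [← hy]; exact h0⟩
  have hzl : ∃ t, y - 1 ≤ t ∧ t ≤ R ∧ τ.up (y - 1 - t) = 0 := by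
    have hT : (-τ.reflect.pos - 1).toNat = y - 1 := by simp only [State.reflect]; omega
    have hed : ∀ t : ℕ, τ.reflect.down (τ.reflect.pos + 1 + t) = τ.up (y - 1 - t) := by
      intro t; simp only [State.reflect]; congr 1; rw [hy]; ring
    have hed0 : τ.reflect.down (τ.reflect.pos + 1 + 0) = τ.up (y - 1) := by
      simpa using hed 0
    have hup : τ.up y = r := by
      have := hτ.balance y
      rw [hr, hy]
      rw [hy] at this
      split_ifs at this <;> omega
    have hupp : τ.up (y - 1) ≤ τ.down y + 1 := by
      have := hτ.balance (y - 1)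
      rw [hy, sub_add_cancel] at this
      split_ifs at * <;> omega
    have hupp' : (τ.up (y - 1) : ℝ) ≤ τ.down y + 1 := by exact_mod_cast hupp
    have hdiff := hg.diff_le
    rw [hy, hup, abs_le] at hdiff
    obtain ⟨t, h1, ht, h0⟩ := (h.noisyFall hτ.reflect hg.left hK hε).exists_eq_zero hθ hθ' (by
      simp only [hT, hed0, Nat.cast_zero]
      have hy1 : ((y - 1 : ℕ) : ℝ) ≤ 8 * N := by exact_mod_cast (by omega : y - 1 ≤ 8 * N)
      have : ((τ.up (y - 1) : ℝ) + (y - 1 : ℕ) + 3 * δ) / θ ≤ 17 * N / θ := by gcongr; linarith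
      linarith)
    rw [hT] at h1
    exact ⟨t, h1, ht, by rw [← hed]; exact h0⟩
  have hRry : 2 * r + 2 * y ≤ R := by omega
  have prof := h.profile hτ hg hK hε hy hr.symm hzr hzl hRry
  set η := 2 * (K + 1 + ε * R + 2 * δ) + 2 * δ + 10 with hη
  set ρ := 2 * r + y with hρ
  have hmass : |(n : ℝ) - (ρ : ℝ) ^ 2| ≤ (2 * R + 3) * η := by
    set S := Finset.Icc ((y : ℤ) - 1 - R) (y + 1 + R) with hS
    have hs1 : ∑ j ∈ S, (τ.up j + τ.down j) = n := by
      rw [← hτ.sum_eq (S ∪ Finset.Ioo (-n : ℤ) n) Finset.subset_union_right]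
      apply Finset.sum_subset Finset.subset_union_left
      intro j _ hj
      apply (prof j).2
      rw [hS, Finset.mem_Icc] at hj
      rw [lt_abs]; omega
    have hs2 := sum_tent ρ S (Finset.Icc_subset_Icc (by omega) (by omega))
    rw [← hs1, ← hs2, Nat.cast_sum, ← Finset.sum_sub_distrib]
    refine (Finset.abs_sum_le_sum_abs _ _).trans ?_
    refine (Finset.sum_le_card_nsmul _ _ _ fun j _ => (prof j).1).trans (le_of_eq ?_)
    rw [hS, Int.card_Icc, nsmul_eq_mul]
    have : ((y : ℤ) + 1 + R + 1 - (y - 1 - R)).toNat = 2 * R + 3 := by omega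
    rw [this]; push_cast; ring
  have hroot : |√n - ρ| ≤ √((2 * R + 3) * η) := by
    apply Real.le_sqrt_of_sq_le
    refine le_trans ?_ hmass
    have h1 : (n : ℝ) - (ρ : ℝ) ^ 2 = (√n - ρ) * (√n + ρ) := by
      nth_rewrite 1 [← Real.sq_sqrt (Nat.cast_nonneg (α := ℝ) n)]; ring
    have hs0 : 0 ≤ √(n : ℝ) := Real.sqrt_nonneg _
    have hρ0 : (0 : ℝ) ≤ ρ := Nat.cast_nonneg _
    rw [h1, abs_mul, sq]
    refine mul_le_mul_of_nonneg_left ?_ (abs_nonneg _)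
    rw [abs_of_nonneg (a := √(n : ℝ) + ρ) (by positivity), abs_le]
    constructor <;> linarith
  have h3 : |max ((ρ : ℝ) - |(j : ℝ)|) 0 - max (√n - |(j : ℝ)|) 0| ≤ √((2 * R + 3) * η) := by
    apply abs_max_zero_sub_le
    rw [abs_sub_comm] at hroot
    convert hroot using 2; ring
  refine (abs_sub_le _ (max ((ρ : ℝ) - |(j : ℝ)|) 0) _).trans ?_
  exact add_le_add (prof j).1 h3

lemma abs_localTime_sub_le {n N R c' : ℕ} {τ : State} (hτ : Reach n τ) {δ ε θ : ℝ}
    {K : ℕ} (hg : GoodState p R δ τ) (hK : ∀ x, K ≤ x → drift p x ≤ -(1 / 2) + ε) (hε : 0 ≤ ε)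
    (hθ : 0 < θ) (hθ' : ∀ d, d ≠ 0 → drift p d ≤ -θ) (hN : 0 < N) (hn : n ≤ N ^ 2) (hδ : δ ≤ N)
    (hc : 17 / θ + 30 ≤ c') (hR : R = c' * N) (j : ℤ) :
    |((τ.up j + τ.down j : ℕ) : ℝ) - max (√n - |(j : ℝ)|) 0| ≤
      (2 * (K + 1 + ε * R + 2 * δ) + 2 * δ + 10) +
      √((2 * R + 3) * (2 * (K + 1 + ε * R + 2 * δ) + 2 * δ + 10)) := by
  rcases le_total 0 τ.pos with hpos | hpos
  · exact h.abs_localTime_sub_le_of_nonneg hτ hg hK hε hθ hθ' hN hn hδ hc hR hpos j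
  · have := h.abs_localTime_sub_le_of_nonneg hτ.reflect hg.reflect hK hε hθ hθ' hN hn hδ hc hR
      (by simp only [State.reflect]; omega) (-j)
    simp only [State.reflect, neg_neg, Int.cast_neg, abs_neg] at this
    rwa [add_comm (τ.up j)]

/-- With constants chosen appropriately, the local times of a good state are uniformly within
`a * √n` of the tent. -/
lemma exists_goodState_profile {a : ℝ} (ha : 0 < a) : ∃ (c' : ℕ) (ε : ℝ) (n₀ : ℕ), 0 < c' ∧ 0 < ε ∧
    ∀ n ≥ n₀, ∀ τ, Reach n τ → GoodState p (c' * (n.sqrt + 1)) (ε * ((n.sqrt + 1 : ℕ) : ℝ)) τ →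
      ∀ j : ℤ, |((τ.up j + τ.down j : ℕ) : ℝ) - max (√n - |(j : ℝ)|) 0| ≤ a * √n := by
  obtain ⟨θ, hθ, hθ'⟩ := h.exists_drift_le
  obtain ⟨c', hc'⟩ := exists_nat_ge (17 / θ + 30)
  have hc0 : (30 : ℝ) ≤ c' := le_trans (by linarith [show (0 : ℝ) ≤ 17 / θ by positivity]) hc'
  set M : ℝ := 2 * c' + 7 with hM
  have hM0 : 0 < M := by positivity
  set x : ℝ := min 1 (a / (4 * M)) with hx
  have hx0 : 0 < x := lt_min one_pos (by positivity)
  have hx1 : x ≤ 1 := min_le_left _ _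
  have hxa : x * (4 * M) ≤ a := by
    rw [← le_div_iff₀ (by positivity)]; exact min_le_right _ _
  set ε : ℝ := x ^ 2 with hε
  have hε0 : 0 < ε := by positivity
  have hεx : ε ≤ x := by rw [hε]; nlinarith
  have hε1 : ε ≤ 1 := hεx.trans hx1
  obtain ⟨K, hK⟩ : ∃ K : ℕ, ∀ d, K ≤ d → drift p d ≤ -(1 / 2) + ε := by
    have := h.tendsto_drift.eventually_le_const (show -(1 / 2 : ℝ) < -(1 / 2) + ε by linarith)
    exact eventually_atTop.1 this
  obtain ⟨N₀, hN₀⟩ := exists_nat_ge ((2 * K + 12) / ε)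
  refine ⟨c', ε, N₀ ^ 2 + 1, by exact_mod_cast (by linarith : (0 : ℝ) < c'), hε0,
    fun n hn τ hτ hg j => ?_⟩
  have hs1 : n < (n.sqrt + 1) ^ 2 := Nat.lt_succ_sqrt' n
  have hs2 : N₀ ≤ n.sqrt := by rw [Nat.le_sqrt']; omega
  have hs3 : 1 ≤ n.sqrt := by rw [Nat.le_sqrt']; omega
  have hs4 : ((n.sqrt : ℕ) : ℝ) ≤ √n := Real.nat_sqrt_le_real_sqrt
  have hs3' : (1 : ℝ) ≤ n.sqrt := by exact_mod_cast hs3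
  set N := n.sqrt + 1 with hN
  have hN1 : (1 : ℝ) ≤ N := by rw [hN]; push_cast; linarith
  have hNn : (N : ℝ) ≤ 2 * √n := by rw [hN]; push_cast; linarith
  have hKN : 2 * K + 12 ≤ ε * N := by
    rw [div_le_iff₀ hε0] at hN₀
    have : (N₀ : ℝ) ≤ N := by exact_mod_cast (by omega : N₀ ≤ N)
    nlinarith
  have key := h.abs_localTime_sub_le hτ hg hK hε0.le hθ hθ' (Nat.succ_pos _) hs1.le
    (by nlinarith) hc' rfl j
  have hη : 2 * (K + 1 + ε * ((c' * N : ℕ) : ℝ) + 2 * (ε * (N : ℝ))) + 2 * (ε * (N : ℝ)) + 10 ≤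
      M * ε * N := by
    rw [hM]; push_cast; linarith
  have hsqrt : √((2 * ((c' * N : ℕ) : ℝ) + 3) * (2 * (K + 1 + ε * ((c' * N : ℕ) : ℝ) +
      2 * (ε * (N : ℝ))) + 2 * (ε * (N : ℝ)) + 10)) ≤ M * x * N := by
    apply Real.sqrt_le_iff.2 ⟨by positivity, ?_⟩
    calc _ ≤ (M * N) * (M * ε * N) := by
          apply mul_le_mul _ hη (by positivity) (by positivity)
          rw [hM]; push_cast; nlinarith
      _ = _ := by rw [hε]; ring
  calc _ ≤ _ := key
    _ ≤ M * ε * N + M * x * N := add_le_add hη hsqrt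
    _ ≤ M * x * N + M * x * N := by gcongr
    _ = 2 * M * x * N := by ring
    _ ≤ 2 * M * x * (2 * √n) := by gcongr
    _ = x * (4 * M) * √n := by ring
    _ ≤ a * √n := by gcongr

end AttractedChain

end SelfRepelling

namespace SelfRepelling

open State

lemma SmallNoise.abs_diff_le {p c : ℤ → ℝ} (h : AttractedChain p c) {R : ℕ} (hR : 1 ≤ R) {δ : ℝ}
    {τ : State} (hs : SmallNoise p R δ τ) :
    |(τ.up (τ.pos + 1) : ℝ) - τ.down (τ.pos + 1)| ≤ δ + 1 := by
  have h1 := hs 1 hR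
  rw [Finset.sum_range_one, noise, abs_le] at h1
  simp only [Nat.cast_zero, add_zero] at h1
  have h2 := h.drift_nonpos (τ.down (τ.pos + 1))
  have h3 := h.neg_half_le_drift (τ.down (τ.pos + 1))
  rw [abs_le]
  constructor <;> linarith

lemma abs_diff_stepUp_le {p c : ℤ → ℝ} (h : AttractedChain p c) {R : ℕ} (hR : 1 ≤ R) {δ : ℝ}
    {τ : State} (hs : SmallNoise p R δ τ) :
    |(τ.stepUp.up τ.stepUp.pos : ℝ) - τ.stepUp.down τ.stepUp.pos| ≤ δ + 1 := by
  have := hs.abs_diff_le h hR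
  simp only [stepUp]
  rwa [Function.update_of_ne (by omega)]

lemma abs_diff_stepDown_le {p c : ℤ → ℝ} (h : AttractedChain p c) {R : ℕ} (hR : 1 ≤ R) {δ : ℝ}
    {τ : State} (hs : SmallNoise p R δ τ.reflect) :
    |(τ.stepDown.up τ.stepDown.pos : ℝ) - τ.stepDown.down τ.stepDown.pos| ≤ δ + 1 := by
  have h1 := abs_diff_stepUp_le h hR hs
  rw [← reflect_stepDown, abs_sub_comm] at h1
  simpa only [State.reflect, neg_neg] using h1

namespace AttractedChain

variable {p c : ℤ → ℝ} (h : AttractedChain p c)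
include h

open Classical in
lemma expect_not_smallNoise_le {K l : ℝ} (hl : 0 ≤ l) (hK : ∀ d n : ℕ, ∑ u ∈ Finset.range n,
    upCount p d u 0 * Real.exp (l * (u - d - drift p d)) ≤ Real.exp (K * l ^ 2))
    (hK' : ∀ d n : ℕ, ∑ u ∈ Finset.range n,
    upCount p d u 0 * Real.exp (-l * (u - d - drift p d)) ≤ Real.exp (K * (-l) ^ 2))
    (hK0 : 0 ≤ K) (n R : ℕ) (δ : ℝ) :
    expect p n (fun τ => if SmallNoise p R δ τ then 0 else 1) start ≤
      2 * (R + 1) * ((2 * n + 1) * (n + 1)) * Real.exp (R * (K * l ^ 2) - l * δ) := by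
  refine le_trans (le_of_eq ?_) (h.expect_noise_bad_le hl hK hK' hK0 n R δ)
  congr 1
  ext τ
  by_cases h1 : SmallNoise p R δ τ
  · rw [if_pos h1, if_neg]
    rintro ⟨L, hL, hlt⟩
    exact absurd (h1 L hL) (not_le.2 hlt)
  · rw [if_neg h1, if_pos]
    rw [SmallNoise] at h1
    push Not at h1
    exact h1

open Classical in
/-- The weight of the states which are not good, in terms of those with large noise. -/
lemma expect_not_goodState_le {R : ℕ} (hR : 1 ≤ R) (δ : ℝ) (n : ℕ) :
    expect p (n + 1) (fun τ => if GoodState p R δ τ then 0 else 1) start ≤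
      2 * expect p (n + 1) (fun τ => if SmallNoise p R δ τ then 0 else 1) start +
      2 * expect p n (fun τ => if SmallNoise p R δ τ then 0 else 1) start := by
  set f : State → ℝ := fun τ => if SmallNoise p R δ τ then 0 else 1 with hf
  set g : State → ℝ := fun τ => if |(τ.up τ.pos : ℝ) - τ.down τ.pos| ≤ δ + 1 then 0 else 1 with hg
  have href : ∀ m, expect p m (fun τ => f τ.reflect) start = expect p m f start := by
    intro m; rw [h.expect_reflect, reflect_start]
  have hf0 : ∀ τ, 0 ≤ f τ := fun τ => by simp only [hf]; split_ifs <;> norm_num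
  have hg0 : ∀ τ, 0 ≤ g τ := fun τ => by simp only [hg]; split_ifs <;> norm_num
  have h1 : expect p (n + 1) (fun τ => if GoodState p R δ τ then 0 else 1) start ≤
      expect p (n + 1) (fun τ => f τ + f τ.reflect + g τ) start := by
    refine h.expect_start_mono fun τ _ => ?_
    split_ifs with hgood
    · exact add_nonneg (add_nonneg (hf0 _) (hf0 _)) (hg0 _)
    · by_contra! hc
      refine hgood ⟨?_, ?_, ?_⟩ <;> by_contra hn
      · have : f τ = 1 := if_neg hn
        linarith [hf0 τ.reflect, hg0 τ]
      · have : f τ.reflect = 1 := if_neg hn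
        linarith [hf0 τ, hg0 τ]
      · have : g τ = 1 := if_neg hn
        linarith [hf0 τ, hf0 τ.reflect]
  have h2 : expect p (n + 1) g start ≤ expect p n (fun τ => f τ + f τ.reflect) start := by
    rw [expect_succ']
    refine h.expect_start_mono fun τ _ => ?_
    have hu : g τ.stepUp ≤ f τ := by
      by_cases hs : SmallNoise p R δ τ
      · have : g τ.stepUp = 0 := if_pos (abs_diff_stepUp_le h hR hs)
        rw [this]; exact hf0 _
      · have : f τ = 1 := if_neg hs
        rw [this]; simp only [hg]; split_ifs <;> norm_num
    have hd : g τ.stepDown ≤ f τ.reflect := by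
      by_cases hs : SmallNoise p R δ τ.reflect
      · have : g τ.stepDown = 0 := if_pos (abs_diff_stepDown_le h hR hs)
        rw [this]; exact hf0 _
      · have : f τ.reflect = 1 := if_neg hs
        rw [this]; simp only [hg]; split_ifs <;> norm_num
    have hp := h.pos (τ.diff τ.pos)
    have hq := h.one_sub_pos (τ.diff τ.pos)
    show p (τ.diff τ.pos) * g τ.stepUp + (1 - p (τ.diff τ.pos)) * g τ.stepDown ≤ _
    nlinarith [hf0 τ, hf0 τ.reflect]
  rw [expect_add, expect_add, href] at h1
  rw [expect_add, href] at h2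
  linarith

/-- The expected local time at a site is close to the tent of area `n`. -/
lemma abs_expect_localTime_sub_le {a : ℝ} (ha : 0 < a) : ∃ C : ℝ, ∀ (n : ℕ) (j : ℤ),
    |expect p n (fun τ => ((τ.up j + τ.down j : ℕ) : ℝ)) start - max (√n - |(j : ℝ)|) 0| ≤
      a * √n + C := by
  classical
  obtain ⟨c', ε, n₀, hc0, hε, hgood⟩ := h.exists_goodState_profile ha
  obtain ⟨K, l₀, hK0, hl₀, hK⟩ := h.exists_exp_moment_le
  have hc0' : (0 : ℝ) < c' := by exact_mod_cast hc0
  set l : ℝ := min l₀ (ε / (2 * K * c')) with hl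
  have hl0 : 0 < l := lt_min hl₀ (by positivity)
  have hlK : l * (2 * K * c') ≤ ε := by
    rw [← le_div_iff₀ (by positivity)]; exact min_le_right _ _
  have hll : |l| ≤ l₀ := by rw [abs_of_pos hl0]; exact min_le_left _ _
  set κ : ℝ := l * ε / 2 with hκ
  have hκ0 : 0 < κ := by positivity
  set C : ℝ := 48 * (c' + 1) * ((Nat.factorial 7 : ℕ) / κ ^ 7) with hC
  have hC0 : 0 ≤ C := by positivity
  have htriv : ∀ (n : ℕ) (j : ℤ) (τ : State), Reach n τ →
      |((τ.up j + τ.down j : ℕ) : ℝ) - max (√n - |(j : ℝ)|) 0| ≤ n := by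
    intro n j τ hτ
    have h1 : ((τ.up j + τ.down j : ℕ) : ℝ) ≤ n := by exact_mod_cast hτ.add_le j
    have h2 : (0 : ℝ) ≤ ((τ.up j + τ.down j : ℕ) : ℝ) := Nat.cast_nonneg _
    have h3 : √(n : ℝ) ≤ n := by
      rcases Nat.eq_zero_or_pos n with rfl | hn
      · simp
      · have : (1 : ℝ) ≤ n := by exact_mod_cast hn
        rw [Real.sqrt_le_iff]
        exact ⟨by linarith, by nlinarith⟩
    have h4 : max (√(n : ℝ) - |(j : ℝ)|) 0 ≤ n :=
      max_le (by linarith [abs_nonneg (j : ℝ)]) (Nat.cast_nonneg _)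
    have h5 := le_max_right (√(n : ℝ) - |(j : ℝ)|) 0
    rw [abs_le]
    constructor <;> linarith
  have habs : ∀ (n : ℕ) (j : ℤ),
      |expect p n (fun τ => ((τ.up j + τ.down j : ℕ) : ℝ)) start - max (√n - |(j : ℝ)|) 0| ≤
      expect p n (fun τ => |((τ.up j + τ.down j : ℕ) : ℝ) - max (√n - |(j : ℝ)|) 0|) start := by
    intro n j
    set t := max (√(n : ℝ) - |(j : ℝ)|) 0 with ht
    have e1 : expect p n (fun τ => ((τ.up j + τ.down j : ℕ) : ℝ)) start - t =
        expect p n (fun τ => ((τ.up j + τ.down j : ℕ) : ℝ) + -t) start := by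
      rw [expect_add, expect_const]; ring
    rw [e1, abs_le]
    constructor
    · have e2 := expect_const_mul p n (-1) (fun τ => |((τ.up j + τ.down j : ℕ) : ℝ) - t|) start
      rw [neg_one_mul] at e2
      rw [← e2]
      refine h.expect_start_mono fun τ _ => ?_
      linarith [neg_abs_le (((τ.up j + τ.down j : ℕ) : ℝ) - t)]
    · exact h.expect_start_mono fun τ _ => le_abs_self _
  refine ⟨C + n₀ + 1, fun n j => (habs n j).trans ?_⟩
  have hs0 : 0 ≤ a * √n := by positivity
  rcases lt_or_ge n (n₀ + 1) with hn | hn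
  · have h1 := h.expect_start_mono (n := n) (fun τ hτ => htriv n j τ hτ)
    rw [expect_const] at h1
    have : (n : ℝ) ≤ n₀ + 1 := by exact_mod_cast hn.le
    linarith
  · obtain ⟨m, rfl⟩ : ∃ m, n = m + 1 := ⟨n - 1, by omega⟩
    set n := m + 1 with hn'
    set N := n.sqrt + 1 with hN
    set R := c' * N with hR
    set δ : ℝ := ε * (N : ℝ) with hδ
    have hN1 : 1 ≤ N := by omega
    have hN1' : (1 : ℝ) ≤ N := by exact_mod_cast hN1
    have hnN : (n : ℝ) ≤ N ^ 2 := by exact_mod_cast (Nat.lt_succ_sqrt' n).le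
    have hn1 : (1 : ℝ) ≤ n := by exact_mod_cast (by omega : 1 ≤ n)
    set B : ℝ := 2 * (R + 1) * ((2 * n + 1) * (n + 1)) * Real.exp (R * (K * l ^ 2) - l * δ) with hB
    have hb1 := h.expect_not_smallNoise_le hl0.le (fun d n => hK d n l hll)
      (fun d n => hK d n (-l) (by rwa [abs_neg])) hK0.le n R δ
    have hb2 := h.expect_not_smallNoise_le hl0.le (fun d n => hK d n l hll)
      (fun d n => hK d n (-l) (by rwa [abs_neg])) hK0.le m R δ
    have hmn : (m : ℝ) ≤ n := by rw [hn']; push_cast; linarith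
    have hb2' : 2 * (R + 1) * ((2 * m + 1) * (m + 1)) * Real.exp (R * (K * l ^ 2) - l * δ) ≤ B := by
      rw [hB]; gcongr
    have hbad := h.expect_not_goodState_le (R := R) (Nat.mul_pos hc0 hN1) δ m
    have hbad4 : expect p n (fun τ => if GoodState p R δ τ then 0 else 1) start ≤ 4 * B := by
      linarith
    have hexp : Real.exp (R * (K * l ^ 2) - l * δ) ≤ Real.exp (-(κ * N)) := by
      apply Real.exp_le_exp.2
      have : l * N * (l * (2 * K * c')) ≤ l * N * ε :=
        mul_le_mul_of_nonneg_left hlK (by positivity)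
      rw [hR, hδ, hκ]; push_cast; nlinarith
    have hpoly : (N : ℝ) ^ 7 * Real.exp (-(κ * N)) ≤ (Nat.factorial 7 : ℕ) / κ ^ 7 := by
      have := Real.pow_div_factorial_le_exp (x := κ * N) (by positivity) 7
      rw [Real.exp_neg, ← div_eq_mul_inv, div_le_div_iff₀ (Real.exp_pos _) (by positivity)]
      rw [div_le_iff₀ (by positivity), mul_pow] at this
      linarith
    have hBC : n * (4 * B) ≤ C := by
      calc n * (4 * B) ≤ (N : ℝ) ^ 2 * (4 * (2 * ((c' + 1) * N) * ((3 * N ^ 2) * (2 * N ^ 2)) *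
            Real.exp (-(κ * N)))) := by
            rw [hB]
            gcongr
            · rw [hR]; push_cast; linarith
            · nlinarith
            · nlinarith
        _ = 48 * (c' + 1) * ((N : ℝ) ^ 7 * Real.exp (-(κ * N))) := by ring
        _ ≤ C := by rw [hC]; gcongr
    have hfin : expect p n (fun τ => |((τ.up j + τ.down j : ℕ) : ℝ) - max (√n - |(j : ℝ)|) 0|) start
        ≤ expect p n (fun τ => a * √n + n * if GoodState p R δ τ then 0 else 1) start := by
      refine h.expect_start_mono fun τ hτ => ?_
      split_ifs with hg
      · rw [mul_zero, add_zero]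
        exact hgood n (by omega) τ hτ hg j
      · linarith [htriv n j τ hτ]
    rw [expect_add, expect_const, expect_const_mul] at hfin
    have := mul_le_mul_of_nonneg_left hbad4 (Nat.cast_nonneg (α := ℝ) n)
    have : (0 : ℝ) ≤ n₀ := Nat.cast_nonneg _
    linarith

end AttractedChain

end SelfRepelling

namespace SelfRepelling

/-- Probability of an up-step from a site with difference `z` of up-exits and down-exits. -/
def upProb (w : ℤ → ℝ) (z : ℤ) : ℝ := w (-z) / (w z + w (-z))

/-- Edge conductances of the chain with up-step probabilities `upProb w`. -/
def conductance (w : ℤ → ℝ) : ℤ → ℝ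
  | Int.ofNat n => ∏ i ∈ Finset.range n, w (-((i : ℤ) + 1)) / w ((i : ℤ) + 1)
  | Int.negSucc n => ∏ i ∈ Finset.range n, w (-((i : ℤ) + 1)) / w ((i : ℤ) + 1)

lemma attractedChain_of_goodWeight {w : ℤ → ℝ} (hw : GoodWeight w) :
    AttractedChain (upProb w) (conductance w) := by
  obtain ⟨hpos, hmono, a, ha, hlim⟩ := hw
  have hm : Monotone w := monotone_int_of_le_succ hmono
  have hsum : ∀ z, 0 < w z + w (-z) := fun z => add_pos (hpos _) (hpos _)
  obtain ⟨z₀, hz₀⟩ := eventually_atTop.1 hlim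
  have hcpos : ∀ n : ℕ, 0 < ∏ i ∈ Finset.range n, w (-((i : ℤ) + 1)) / w ((i : ℤ) + 1) :=
    fun n => Finset.prod_pos fun i _ => div_pos (hpos _) (hpos _)
  set γ : ℝ := w 0 / (w 0 + a) with hγ
  have hγ0 : 0 < γ := div_pos (hpos 0) (add_pos (hpos 0) ha)
  have hγ1 : γ < 1 := by
    rw [hγ, div_lt_one (add_pos (hpos 0) ha)]; linarith
  have hle1 : ∀ i : ℕ, w (-((i : ℤ) + 1)) / w ((i : ℤ) + 1) ≤ 1 := fun i => by
    rw [div_le_one (hpos _)]; exact hm (by omega)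
  have hleγ : ∀ i : ℕ, z₀.toNat ≤ i → w (-((i : ℤ) + 1)) / w ((i : ℤ) + 1) ≤ γ := fun i hi => by
    have h1 := hz₀ ((i : ℤ) + 1) (by omega)
    have h2 : w (-((i : ℤ) + 1)) ≤ w 0 := hm (by omega)
    have h3 := hpos (-((i : ℤ) + 1))
    rw [hγ, div_le_div_iff₀ (hpos _) (add_pos (hpos 0) ha)]
    nlinarith [hpos 0]
  have hdecay : ∀ n : ℕ, ∏ i ∈ Finset.range n, w (-((i : ℤ) + 1)) / w ((i : ℤ) + 1) ≤
      γ ^ n / γ ^ z₀.toNat := by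
    intro n
    rcases le_or_gt n z₀.toNat with hn | hn
    · calc _ ≤ (1 : ℝ) := Finset.prod_le_one (fun i _ => (div_pos (hpos _) (hpos _)).le)
            fun i _ => hle1 i
        _ ≤ _ := by
          rw [one_le_div (by positivity)]
          exact pow_le_pow_of_le_one hγ0.le hγ1.le hn
    · induction n, hn.le using Nat.le_induction with
      | base => exact absurd hn (lt_irrefl _)
      | succ n hn' ih =>
        rw [Finset.prod_range_succ, pow_succ, mul_div_right_comm]
        refine mul_le_mul ?_ (hleγ n hn') (div_pos (hpos _) (hpos _)).le (by positivity)
        rcases hn'.lt_or_eq with h' | h'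
        · exact ih h'
        · rw [← h', div_self (by positivity)]
          exact Finset.prod_le_one (fun i _ => (div_pos (hpos _) (hpos _)).le) fun i _ => hle1 i
  refine ⟨fun z => div_pos (hpos _) (hsum z), fun z => ?_, fun z hz => ?_, ⟨z₀, fun z hz => ?_⟩,
    fun z => ?_, ?_, fun z => ?_, fun z => ?_, ⟨γ⁻¹ / γ ^ z₀.toNat, γ, by positivity, hγ0, hγ1,
    fun z => ?_⟩⟩
  · have := hsum z
    rw [upProb, upProb, neg_neg, add_comm (w (-z)), eq_sub_iff_add_eq, ← add_div,
      div_self this.ne']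
  · have : w (-z) ≤ w z := hm (by omega)
    rw [upProb, div_le_div_iff₀ (hsum z) two_pos]; linarith
  · have := hz₀ z hz
    rw [upProb, div_lt_div_iff₀ (hsum z) two_pos]; linarith
  · cases z <;> exact hcpos _
  · exact Finset.prod_range_zero _
  · cases z with
    | ofNat n =>
      have : -1 - Int.ofNat n = Int.negSucc n := by simp only [Int.ofNat_eq_natCast]; omega
      rw [this]; rfl
    | negSucc n =>
      have : -1 - Int.negSucc n = Int.ofNat n := by simp only [Int.ofNat_eq_natCast]; omega
      rw [this]; rfl
  · have h1 : 1 - upProb w z = w z / (w z + w (-z)) := by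
      have := (hsum z).ne'
      rw [upProb]; field_simp; ring
    suffices hc : conductance w z * w z = conductance w (z - 1) * w (-z) by
      rw [h1, upProb, ← mul_div_assoc, hc, mul_div_assoc]
    rcases lt_trichotomy z 0 with hz | rfl | hz
    · obtain ⟨n, rfl⟩ : ∃ n : ℕ, z = -((n : ℤ) + 1) := ⟨(-z - 1).toNat, by omega⟩
      have e1 : -((n : ℤ) + 1) = Int.negSucc n := by omega
      have e2 : -((n : ℤ) + 1) - 1 = Int.negSucc (n + 1) := by omega
      have c1 : conductance w (-((n : ℤ) + 1)) =
        ∏ i ∈ Finset.range n, w (-((i : ℤ) + 1)) / w ((i : ℤ) + 1) := by rw [e1]; rfl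
      have c2 : conductance w (-((n : ℤ) + 1) - 1) =
        ∏ i ∈ Finset.range (n + 1), w (-((i : ℤ) + 1)) / w ((i : ℤ) + 1) := by rw [e2]; rfl
      rw [c1, c2, Finset.prod_range_succ, neg_neg, mul_assoc, div_mul_cancel₀ _ (hpos _).ne']
    · have c1 : conductance w 0 = 1 := Finset.prod_range_zero _
      have c2 : conductance w (0 - 1) = 1 := Finset.prod_range_zero _
      rw [c1, c2, neg_zero]
    · obtain ⟨n, rfl⟩ : ∃ n : ℕ, z = (n : ℤ) + 1 := ⟨(z - 1).toNat, by omega⟩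
      have c1 : conductance w ((n : ℤ) + 1) =
        ∏ i ∈ Finset.range (n + 1), w (-((i : ℤ) + 1)) / w ((i : ℤ) + 1) := rfl
      have c2 : conductance w ((n : ℤ) + 1 - 1) =
        ∏ i ∈ Finset.range n, w (-((i : ℤ) + 1)) / w ((i : ℤ) + 1) := by
        rw [add_sub_cancel_right]; rfl
      rw [c1, c2, Finset.prod_range_succ, mul_assoc, div_mul_cancel₀ _ (hpos _).ne']
  · cases z with
    | ofNat n =>
      refine (hdecay n).trans ?_
      rw [div_mul_eq_mul_div, Int.natAbs_ofNat']
      gcongr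
      exact le_mul_of_one_le_left (by positivity) ((one_le_inv₀ hγ0).2 hγ1.le)
    | negSucc n =>
      refine (hdecay n).trans (le_of_eq ?_)
      rw [div_mul_eq_mul_div, Int.natAbs_negSucc, Nat.succ_eq_add_one, pow_succ]
      field_simp

end SelfRepelling

namespace SelfRepelling

open State

/-- Indicator of the walker being at `k`. -/
def atSite (k : ℤ) (τ : State) : ℝ := if τ.pos = k then 1 else 0

/-- Expected local times are sums of one-time probabilities. -/
lemma expect_localTime_eq (p : ℤ → ℝ) (k : ℤ) (n : ℕ) (σ : State) :
    expect p n (fun τ => ((τ.up k + τ.down k : ℕ) : ℝ)) σ =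
      ((σ.up k + σ.down k : ℕ) : ℝ) + ∑ i ∈ Finset.range n, expect p i (atSite k) σ := by
  induction n generalizing σ with
  | zero => simp [expect]
  | succ n ih =>
    have hu : ((σ.stepUp.up k + σ.stepUp.down k : ℕ) : ℝ) =
        ((σ.up k + σ.down k : ℕ) : ℝ) + atSite k σ := by
      simp only [stepUp, atSite]
      by_cases hk : σ.pos = k
      · subst hk
        rw [Function.update_self, if_pos rfl]; push_cast; ring
      · rw [Function.update_of_ne (Ne.symm hk), if_neg hk, add_zero]
    have hd : ((σ.stepDown.up k + σ.stepDown.down k : ℕ) : ℝ) =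
        ((σ.up k + σ.down k : ℕ) : ℝ) + atSite k σ := by
      simp only [stepDown, atSite]
      by_cases hk : σ.pos = k
      · subst hk
        rw [Function.update_self, if_pos rfl]; push_cast; ring
      · rw [Function.update_of_ne (Ne.symm hk), if_neg hk, add_zero]
    rw [expect, ih, ih, hu, hd, Finset.sum_range_succ']
    simp only [expect, Finset.sum_add_distrib, ← Finset.mul_sum]
    ring

/-- The state reached by the path `x` at time `m`. -/
def pathState (x : ℕ → ℤ) (m : ℕ) : State := ⟨x m, dirLocP x m, dirLocM x m⟩

lemma pathState_congr {x x' : ℕ → ℤ} {m : ℕ} (hx : ∀ i ≤ m, x i = x' i) :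
    pathState x m = pathState x' m := by
  have h1 : ∀ j ∈ Finset.range m, x j = x' j ∧ x (j + 1) = x' (j + 1) := by
    intro j hj
    rw [Finset.mem_range] at hj
    exact ⟨hx j (by omega), hx (j + 1) (by omega)⟩
  ext k
  · exact hx m le_rfl
  · simp only [pathState, dirLocP]
    rw [Finset.filter_congr fun j hj => by rw [(h1 j hj).1, (h1 j hj).2]]
  · simp only [pathState, dirLocM]
    rw [Finset.filter_congr fun j hj => by rw [(h1 j hj).1, (h1 j hj).2]]

lemma dirLocP_succ (x : ℕ → ℤ) (m : ℕ) (k : ℤ) : dirLocP x (m + 1) k =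
    dirLocP x m k + if x m = k ∧ x (m + 1) = k + 1 then 1 else 0 := by
  rw [dirLocP, Finset.range_add_one, Finset.filter_insert]
  split_ifs
  · rw [Finset.card_insert_of_notMem (by simp), dirLocP]
  · rfl

lemma dirLocM_succ (x : ℕ → ℤ) (m : ℕ) (k : ℤ) : dirLocM x (m + 1) k =
    dirLocM x m k + if x m = k ∧ x (m + 1) = k - 1 then 1 else 0 := by
  rw [dirLocM, Finset.range_add_one, Finset.filter_insert]
  split_ifs
  · rw [Finset.card_insert_of_notMem (by simp), dirLocM]
  · rfl

lemma pathState_succ_of_up {x : ℕ → ℤ} {m : ℕ} (hx : x (m + 1) = x m + 1) :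
    pathState x (m + 1) = (pathState x m).stepUp := by
  ext k
  · exact hx
  · simp only [pathState, stepUp, dirLocP_succ]
    by_cases hk : k = x m
    · subst hk; rw [Function.update_self, if_pos ⟨rfl, hx⟩]
    · rw [Function.update_of_ne hk, if_neg fun h => hk h.1.symm, add_zero]
  · simp only [pathState, stepUp, dirLocM_succ]
    rw [if_neg (by omega), add_zero]

lemma pathState_succ_of_down {x : ℕ → ℤ} {m : ℕ} (hx : x (m + 1) = x m - 1) :
    pathState x (m + 1) = (pathState x m).stepDown := by
  ext k
  · exact hx
  · simp only [pathState, stepDown, dirLocP_succ]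
    rw [if_neg (by omega), add_zero]
  · simp only [pathState, stepDown, dirLocM_succ]
    by_cases hk : k = x m
    · subst hk; rw [Function.update_self, if_pos ⟨rfl, hx⟩]
    · rw [Function.update_of_ne hk, if_neg fun h => hk h.1.symm, add_zero]

section Law

variable {w : ℤ → ℝ} {Ω : Type*} [MeasurableSpace Ω] {μ : Measure Ω} [IsProbabilityMeasure μ]
  {X : ℕ → Ω → ℤ}

omit [IsProbabilityMeasure μ] in
lemma IsSRW.measureReal_prefix_update (hX : IsSRW μ w X) (x : ℕ → ℤ) (m : ℕ) (v : ℤ) :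
    μ.real {ω | ∀ i ≤ m + 1, X i ω = Function.update x (m + 1) v i} =
      μ.real {ω | ∀ i ≤ m, X i ω = x i} *
        max (stepProb w (Function.update x (m + 1) v) m) 0 := by
  rw [Measure.real, hX.2.2, ENNReal.toReal_mul, ENNReal.toReal_ofReal']
  congr 3
  ext ω
  refine forall₂_congr fun i hi => ?_
  rw [Function.update_of_ne (by omega)]

omit [MeasurableSpace Ω] in
lemma setOf_prefix_update (x : ℕ → ℤ) (m : ℕ) (v : ℤ) :
    {ω | ∀ i ≤ m + 1, X i ω = Function.update x (m + 1) v i} =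
      {ω | (∀ i ≤ m, X i ω = x i) ∧ X (m + 1) ω = v} := by
  ext ω
  constructor
  · intro hω
    refine ⟨fun i hi => ?_, ?_⟩
    · rw [hω i (by omega), Function.update_of_ne (by omega)]
    · rw [hω (m + 1) le_rfl, Function.update_self]
  · rintro ⟨h1, h2⟩ i hi
    rcases eq_or_ne i (m + 1) with rfl | hne
    · rw [Function.update_self, h2]
    · rw [Function.update_of_ne hne]; exact h1 i (by omega)

/-- Law of the walk after a given initial segment. -/
lemma IsSRW.measureReal_prefix (hw : ∀ z, 0 < w z) (hX : IsSRW μ w X) (k : ℤ) (n m : ℕ)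
    (x : ℕ → ℤ) :
    μ.real {ω | (∀ i ≤ m, X i ω = x i) ∧ X (m + n) ω = k} =
      μ.real {ω | ∀ i ≤ m, X i ω = x i} * expect (upProb w) n (atSite k) (pathState x m) := by
  induction n generalizing m x with
  | zero =>
    have he : expect (upProb w) 0 (atSite k) (pathState x m) = if x m = k then 1 else 0 := rfl
    rw [he, add_zero]
    split_ifs with hk
    · rw [mul_one]; congr 1; ext ω
      refine ⟨fun h => h.1, fun h => ⟨h, by rw [h m le_rfl, hk]⟩⟩
    · rw [mul_zero]
      convert measureReal_empty (μ := μ)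
      ext ω
      simp only [Set.mem_ofPred_eq, Set.mem_empty_iff_false, iff_false, not_and]
      intro h hm
      exact hk (by rw [← h m le_rfl, hm])
  | succ n ih =>
    set P : Set Ω := {ω | ∀ i ≤ m, X i ω = x i} with hP
    set E : Set Ω := {ω | (∀ i ≤ m, X i ω = x i) ∧ X (m + (n + 1)) ω = k} with hE
    set σ := pathState x m with hσ
    have hmX : ∀ j v, MeasurableSet {ω | X j ω = v} := fun j v =>
      hX.1 j (measurableSet_singleton v)
    have hpart : ∀ v, E ∩ {ω | X (m + 1) ω = v} =
        {ω | (∀ i ≤ m + 1, X i ω = Function.update x (m + 1) v i) ∧ X (m + 1 + n) ω = k} := by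
      intro v
      have := setOf_prefix_update (X := X) x m v
      ext ω
      have h1 : (∀ i ≤ m + 1, X i ω = Function.update x (m + 1) v i) ↔
          (∀ i ≤ m, X i ω = x i) ∧ X (m + 1) ω = v := by
        simpa using Set.ext_iff.1 this ω
      simp only [hE, Set.mem_inter_iff, Set.mem_ofPred_eq, h1, show m + (n + 1) = m + 1 + n by ring]
      tauto
    have hxm : ∀ v, Function.update x (m + 1) v m = x m := fun v =>
      Function.update_of_ne (by omega) _ _
    have hst : ∀ v, pathState (Function.update x (m + 1) v) m = σ := fun v =>
      pathState_congr fun i hi => Function.update_of_ne (by omega) _ _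
    have hdiff : ∀ v, (dirLocP (Function.update x (m + 1) v) m (Function.update x (m + 1) v m) : ℤ) -
        dirLocM (Function.update x (m + 1) v) m (Function.update x (m + 1) v m) =
        σ.diff σ.pos := by
      intro v; rw [← hst v]; rfl
    have hU : μ.real (E ∩ {ω | X (m + 1) ω = x m + 1}) =
        μ.real P * (upProb w (σ.diff σ.pos) * expect (upProb w) n (atSite k) σ.stepUp) := by
      rw [hpart, ih, IsSRW.measureReal_prefix_update hX, pathState_succ_of_up
        (by rw [Function.update_self, hxm]), hst, mul_assoc]
      congr 2
      simp only [stepProb]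
      rw [hdiff, if_pos (by rw [Function.update_self, hxm])]
      exact max_eq_left (div_pos (hw _) (add_pos (hw _) (hw _))).le
    have hD : μ.real (E ∩ {ω | X (m + 1) ω = x m - 1}) =
        μ.real P * ((1 - upProb w (σ.diff σ.pos)) *
          expect (upProb w) n (atSite k) σ.stepDown) := by
      rw [hpart, ih, IsSRW.measureReal_prefix_update hX, pathState_succ_of_down
        (by rw [Function.update_self, hxm]), hst, mul_assoc]
      congr 2
      simp only [stepProb]
      rw [hdiff, if_neg (by rw [Function.update_self, hxm]; omega),
        if_pos (by rw [Function.update_self, hxm]),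
        max_eq_left (div_pos (hw _) (add_pos (hw _) (hw _))).le, upProb]
      have := (add_pos (hw (σ.diff σ.pos)) (hw (-σ.diff σ.pos))).ne'
      field_simp
      ring
    have hrest : μ.real ((E \ {ω | X (m + 1) ω = x m + 1}) \ {ω | X (m + 1) ω = x m - 1}) = 0 := by
      have hnull : μ (⋃ v : {v : ℤ // v ≠ x m + 1 ∧ v ≠ x m - 1},
          {ω | ∀ i ≤ m + 1, X i ω = Function.update x (m + 1) v.1 i}) = 0 := by
        refine measure_iUnion_null fun v => ?_
        rw [hX.2.2, stepProb]
        simp only [Function.update_self, hxm]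
        rw [if_neg v.2.1, if_neg v.2.2, ENNReal.ofReal_zero, mul_zero]
      rw [Measure.real, measure_mono_null _ hnull, ENNReal.toReal_zero]
      rintro ω ⟨⟨h1, h2⟩, h3⟩
      refine Set.mem_iUnion.2 ⟨⟨X (m + 1) ω, h2, h3⟩, ?_⟩
      rw [setOf_prefix_update]
      exact ⟨h1.1, rfl⟩
    have s1 := measureReal_inter_add_sdiff (μ := μ) (s := E) (hmX (m + 1) (x m + 1))
    have s2 := measureReal_inter_add_sdiff (μ := μ)
      (s := E \ {ω | X (m + 1) ω = x m + 1}) (hmX (m + 1) (x m - 1))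
    have s3 : (E \ {ω | X (m + 1) ω = x m + 1}) ∩ {ω | X (m + 1) ω = x m - 1} =
        E ∩ {ω | X (m + 1) ω = x m - 1} := by
      ext ω
      simp only [Set.mem_inter_iff, Set.mem_sdiff, Set.mem_ofPred_eq]
      constructor
      · rintro ⟨⟨a, _⟩, b⟩; exact ⟨a, b⟩
      · rintro ⟨a, b⟩; exact ⟨⟨a, by omega⟩, b⟩
    rw [s3, hrest, hD, add_zero] at s2
    rw [hU, ← s2] at s1
    rw [← s1, expect]
    ring

lemma IsSRW.measureReal_eq (hw : ∀ z, 0 < w z) (hX : IsSRW μ w X) (n : ℕ) (k : ℤ) :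
    μ.real {ω | X n ω = k} = expect (upProb w) n (atSite k) start := by
  have h := IsSRW.measureReal_prefix hw hX k n 0 0
  have hst : pathState 0 0 = start := by
    ext j <;> simp [pathState, start, dirLocP, dirLocM]
  have h0 : {ω | ∀ i ≤ 0, X i ω = (0 : ℕ → ℤ) i} = {ω | X 0 ω = 0} := by
    ext ω; simp
  have h1 : μ.real {ω | X 0 ω = 0} = 1 := by rw [Measure.real, hX.2.1, ENNReal.toReal_one]
  rw [hst, h0, h1, one_mul] at h
  rw [← h]
  have hae : ∀ᵐ ω ∂μ, X 0 ω = 0 :=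
    (mem_ae_iff_prob_eq_one (hX.1 0 (measurableSet_singleton 0))).2 hX.2.1
  apply measureReal_congr
  filter_upwards [hae] with ω hω
  apply propext
  change X n ω = k ↔ (∀ i ≤ 0, X i ω = (0 : ℕ → ℤ) i) ∧ X (0 + n) ω = k
  simp [hω]

/-- The expected local time at a site is close to the tent of area `n`. -/
lemma abs_sum_measureReal_sub_le (hw : GoodWeight w) (hX : IsSRW μ w X) {a : ℝ} (ha : 0 < a) :
    ∃ C : ℝ, ∀ (n : ℕ) (k : ℤ),
      |∑ i ∈ Finset.range n, μ.real {ω | X i ω = k} - max (√n - |(k : ℝ)|) 0| ≤ a * √n + C := by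
  obtain ⟨C, hC⟩ := (attractedChain_of_goodWeight hw).abs_expect_localTime_sub_le ha
  refine ⟨C, fun n k => ?_⟩
  have := hC n k
  rw [expect_localTime_eq] at this
  simp only [start, Pi.zero_apply, add_zero, Nat.cast_zero, zero_add] at this
  rw [Finset.sum_congr rfl fun i _ => IsSRW.measureReal_eq hw.1 hX i k]
  exact this

end Law

end SelfRepelling

namespace SelfRepelling

open Set

lemma integrableOn_exp_mul_affine {s : ℝ} (hs : 0 < s) (c d : ℝ) :
    IntegrableOn (fun t : ℝ => s * Real.exp (-s * t) * (c * t + d)) (Ioi 0) := by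
  have h1 := integrableOn_rpow_mul_exp_neg_mul_rpow (p := 1) (s := 1) (b := s)
    (by norm_num) one_pos hs
  have h0 := integrableOn_rpow_mul_exp_neg_mul_rpow (p := 1) (s := 0) (b := s)
    (by norm_num) one_pos hs
  simp only [Real.rpow_one, Real.rpow_zero, one_mul] at h0 h1
  refine ((h1.const_mul (s * c)).add (h0.const_mul (s * d))).congr (ae_of_all _ fun t => ?_)
  simp only [Pi.add_apply]
  ring

lemma integrableOn_exp_mul_floor {s A : ℝ} (hs : 0 < s) (hA : 0 < A) {F : ℕ → ℝ}
    (hF : ∀ n, |F n| ≤ n + 1) :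
    IntegrableOn (fun t : ℝ => s * Real.exp (-s * t) * F ⌊A * t⌋₊) (Ioi 0) := by
  refine Integrable.mono' (integrableOn_exp_mul_affine hs A 1) ?_ ?_
  · refine (Measurable.mul (by fun_prop) ?_).aestronglyMeasurable
    exact (measurable_from_top (f := F)).comp (Nat.measurable_floor.comp (by fun_prop))
  · filter_upwards [ae_restrict_mem measurableSet_Ioi] with t ht
    rw [norm_mul, Real.norm_of_nonneg (by positivity : 0 ≤ s * Real.exp (-s * t)), Real.norm_eq_abs]
    refine mul_le_mul_of_nonneg_left ((hF _).trans ?_) (by positivity)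
    have := Nat.floor_le (mul_pos hA ht).le
    linarith

/-- Abel sums as Laplace transforms. -/
lemma hasSum_exp_mul_floor {s A : ℝ} (hs : 0 < s) (hA : 0 < A) {F : ℕ → ℝ}
    (hF : ∀ n, |F n| ≤ n + 1) :
    HasSum (fun n : ℕ => (1 - Real.exp (-s / A)) * (Real.exp (-s * n / A) * F n))
      (∫ t in Ioi (0 : ℝ), s * Real.exp (-s * t) * F ⌊A * t⌋₊) := by
  set S : ℕ → Set ℝ := fun n => Ioi 0 ∩ Ico ((n : ℝ) / A) ((n + 1) / A) with hS
  have hmem : ∀ (n : ℕ) (t : ℝ), t ∈ Ico ((n : ℝ) / A) ((n + 1) / A) ↔ (n : ℝ) ≤ A * t ∧ A * t < n + 1 := by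
    intro n t
    rw [mem_Ico, div_le_iff₀ hA, lt_div_iff₀ hA, mul_comm]
  have hfl : ∀ n, ∀ t ∈ S n, ⌊A * t⌋₊ = n := by
    intro n t ht
    rw [Nat.floor_eq_iff (mul_pos hA ht.1).le]
    exact (hmem n t).1 ht.2
  have hun : ⋃ n, S n = Ioi 0 := by
    ext t
    rw [mem_iUnion]
    refine ⟨fun ⟨n, hn⟩ => hn.1, fun ht => ⟨⌊A * t⌋₊, ht, ?_⟩⟩
    rw [hmem]
    exact ⟨Nat.floor_le (mul_pos hA ht).le, Nat.lt_floor_add_one _⟩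
  have hdis : Pairwise (Function.onFun Disjoint S) := by
    intro m n hmn
    rw [Function.onFun, Set.disjoint_left]
    intro t h1 h2
    exact hmn ((hfl m t h1).symm.trans (hfl n t h2))
  have hmeas : ∀ n, MeasurableSet (S n) := fun n => measurableSet_Ioi.inter measurableSet_Ico
  have key := hasSum_integral_iUnion (μ := volume)
    (f := fun t : ℝ => s * Real.exp (-s * t) * F ⌊A * t⌋₊) hmeas hdis (by
    rw [hun]; exact integrableOn_exp_mul_floor hs hA hF)
  rw [hun] at key
  suffices hterm : ∀ n : ℕ, (1 - Real.exp (-s / A)) * (Real.exp (-s * n / A) * F n) =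
      ∫ t in S n, s * Real.exp (-s * t) * F ⌊A * t⌋₊ by
    simpa only [hterm] using key
  intro n
  rw [setIntegral_congr_fun (hmeas n) (g := fun t : ℝ => F n * (s * Real.exp (-s * t)))
    fun t ht => by simp only [hfl n t ht]; ring, integral_const_mul]
  have hle : (n : ℝ) / A ≤ (n + 1) / A := by gcongr; linarith
  have hsub : Ico ((n : ℝ) / A) ((n + 1) / A) ⊆ Ici 0 :=
    fun t ht => le_trans (by positivity) ht.1
  have hae : S n =ᵐ[volume] Ioc ((n : ℝ) / A) ((n + 1) / A) := by
    have h1 : S n =ᵐ[volume] (Ici 0 ∩ Ico ((n : ℝ) / A) ((n + 1) / A) : Set ℝ) :=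
      ae_eq_set_inter Ioi_ae_eq_Ici (ae_eq_refl _)
    rw [inter_eq_right.2 hsub] at h1
    exact h1.trans Ico_ae_eq_Ioc
  rw [setIntegral_congr_set hae, ← intervalIntegral.integral_of_le hle]
  have hder : ∀ t ∈ uIcc ((n : ℝ) / A) ((n + 1) / A),
      HasDerivAt (fun t : ℝ => -Real.exp (-s * t)) (s * Real.exp (-s * t)) t := by
    intro t _
    have := (((hasDerivAt_id t).const_mul (-s)).exp).neg
    simp only [id, mul_one] at this
    exact this.congr_deriv (by ring)
  rw [intervalIntegral.integral_eq_sub_of_hasDerivAt hder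
    ((by fun_prop : Continuous fun t : ℝ => s * Real.exp (-s * t)).intervalIntegrable _ _)]
  have : Real.exp (-s * ((n + 1) / A)) = Real.exp (-s / A) * Real.exp (-s * n / A) := by
    rw [← Real.exp_add]; congr 1; field_simp; ring
  rw [this, ← mul_div_assoc]
  ring

/-- Summation by parts. -/
lemma tsum_exp_mul_eq {s A : ℝ} (hs : 0 < s) (hA : 0 < A) {P : ℕ → ℝ} (hP : ∀ n, |P n| ≤ 1) :
    ∑' n : ℕ, Real.exp (-s * n / A) * P n =
      ∫ t in Ioi (0 : ℝ), s * Real.exp (-s * t) * ∑ i ∈ Finset.range (⌊A * t⌋₊ + 1), P i := by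
  set q := Real.exp (-s / A) with hq
  have hq1 : 1 - q ≠ 0 := by
    have : q < 1 := Real.exp_lt_one_iff.2 (div_neg_of_neg_of_pos (by linarith) hA)
    linarith
  have hpow : ∀ n : ℕ, Real.exp (-s * ((n + 1 : ℕ) : ℝ) / A) = q * Real.exp (-s * n / A) := by
    intro n
    rw [hq, ← Real.exp_add]; congr 1; push_cast; field_simp; ring
  have hF : ∀ n : ℕ, |∑ i ∈ Finset.range (n + 1), P i| ≤ n + 1 := by
    intro n
    refine (Finset.abs_sum_le_sum_abs _ _).trans ((Finset.sum_le_card_nsmul _ _ 1 fun i _ => hP i).trans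
      (le_of_eq ?_))
    simp
  have h1 := hasSum_exp_mul_floor hs hA hF
  rw [← hq] at h1
  set I := ∫ t in Ioi (0 : ℝ), s * Real.exp (-s * t) * ∑ i ∈ Finset.range (⌊A * t⌋₊ + 1), P i
  have h2 : HasSum (fun n : ℕ => Real.exp (-s * n / A) * ∑ i ∈ Finset.range (n + 1), P i)
      ((1 - q)⁻¹ * I) := by
    have := h1.mul_left (1 - q)⁻¹
    simpa only [inv_mul_cancel_left₀ hq1] using this
  have h3 : HasSum (fun n : ℕ => Real.exp (-s * n / A) * ∑ i ∈ Finset.range n, P i)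
      (q * ((1 - q)⁻¹ * I)) := by
    have h : HasSum (fun n : ℕ => Real.exp (-s * ((n + 1 : ℕ) : ℝ) / A) *
        ∑ i ∈ Finset.range (n + 1), P i) (q * ((1 - q)⁻¹ * I)) := by
      have := h2.mul_left q
      simpa only [hpow, mul_assoc] using this
    have := (hasSum_nat_add_iff (f := fun n : ℕ => Real.exp (-s * n / A) *
      ∑ i ∈ Finset.range n, P i) 1).1 h
    simpa using this
  have h4 := h2.sub h3
  have h5 : (fun n : ℕ => Real.exp (-s * n / A) * ∑ i ∈ Finset.range (n + 1), P i -
      Real.exp (-s * n / A) * ∑ i ∈ Finset.range n, P i) =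
      fun n : ℕ => Real.exp (-s * n / A) * P n := by
    ext n
    rw [Finset.sum_range_succ]; ring
  rw [h5] at h4
  rw [h4.tsum_eq]
  field_simp

lemma integral_exp_mul_max_sqrt {s b : ℝ} (hs : 0 < s) (hb : 0 ≤ b) :
    ∫ t in Ioi (0 : ℝ), s * Real.exp (-s * t) * max (√t - b) 0 =
      ∫ v in Ioi b, Real.exp (-s * v ^ 2) := by
  have hsub : Ioi (b ^ 2) ⊆ Ioi (0 : ℝ) := Ioi_subset_Ioi (sq_nonneg b)
  rw [setIntegral_eq_of_subset_of_forall_sdiff_eq_zero measurableSet_Ioi hsub]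
  swap
  · intro t ht
    rw [max_eq_right, mul_zero]
    have : √t ≤ b := Real.sqrt_le_iff.2 ⟨hb, not_lt.1 ht.2⟩
    linarith
  have hge : ∀ t ∈ Ioi (b ^ 2), 0 ≤ √t - b := fun t ht => by
    have := Real.le_sqrt_of_sq_le (le_of_lt ht)
    linarith
  rw [setIntegral_congr_fun measurableSet_Ioi (g := fun t : ℝ => s * Real.exp (-s * t) * (√t - b))
    fun t ht => by simp only [max_eq_left (hge t ht)]]
  set Ψ : ℝ → ℝ := fun u => ∫ v in b..u, Real.exp (-s * v ^ 2) with hΨ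
  have hcont : Continuous fun v : ℝ => Real.exp (-s * v ^ 2) := by fun_prop
  have hΨd : ∀ u, HasDerivAt Ψ (Real.exp (-s * u ^ 2)) u := fun u =>
    intervalIntegral.integral_hasDerivAt_right (hcont.intervalIntegrable _ _)
      (hcont.stronglyMeasurableAtFilter _ _) hcont.continuousAt
  have hΨc : Continuous Ψ := continuous_iff_continuousAt.2 fun u => (hΨd u).continuousAt
  have hlim : Tendsto (fun t : ℝ => -(Real.exp (-s * t) * (√t - b)) + Ψ √t) atTop
      (𝓝 (-(0 - b * 0) + ∫ v in Ioi b, Real.exp (-s * v ^ 2))) := by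
    refine Tendsto.add (Tendsto.neg ?_) ?_
    · have e1 := tendsto_rpow_mul_exp_neg_mul_atTop_nhds_zero (1 / 2) s hs
      have e0 := tendsto_rpow_mul_exp_neg_mul_atTop_nhds_zero 0 s hs
      refine (e1.sub (e0.const_mul b)).congr fun t => ?_
      rw [Real.rpow_zero, ← Real.sqrt_eq_rpow]; ring
    · exact (intervalIntegral_tendsto_integral_Ioi b (integrable_exp_neg_mul_sq hs).integrableOn
        tendsto_id).comp Real.tendsto_sqrt_atTop
  rw [integral_Ioi_of_hasDerivAt_of_nonneg (g := fun t : ℝ =>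
    -(Real.exp (-s * t) * (√t - b)) + Ψ √t) ?_ ?_ ?_ hlim]
  · have : √(b ^ 2) = b := Real.sqrt_sq hb
    simp only [this, hΨ, intervalIntegral.integral_same]
    ring
  · exact Continuous.continuousWithinAt (by fun_prop)
  · intro t ht
    have ht0 : 0 < t := lt_of_le_of_lt (sq_nonneg b) ht
    have h1 := Real.hasDerivAt_sqrt ht0.ne'
    have h2 : HasDerivAt (fun t : ℝ => Real.exp (-s * t)) (Real.exp (-s * t) * -s) t := by
      simpa using ((hasDerivAt_id t).const_mul (-s)).exp
    have h3 := ((h2.mul (h1.sub_const b)).neg).add ((hΨd (√t)).comp t h1)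
    refine h3.congr_deriv ?_
    rw [Real.sq_sqrt ht0.le]
    ring
  · intro t ht
    exact mul_nonneg (by positivity) (hge t ht)

lemma phiHat_eq {s : ℝ} (hs : 0 < s) (x : ℝ) :
    phiHat s x = s * ∫ v in Ioi |x|, Real.exp (-s * v ^ 2) := by
  set z := √(2 * s) * |x| with hz
  have hs2 : 0 < √(2 * s) := Real.sqrt_pos.2 (by linarith)
  have hinteg : Integrable fun y : ℝ => Real.exp (-(y ^ 2) / 2) := by
    refine (integrable_exp_neg_mul_sq (b := 1 / 2) (by norm_num)).congr (ae_of_all _ fun y => ?_)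
    simp only; congr 1; ring
  have htot : ∫ y : ℝ, Real.exp (-(y ^ 2) / 2) = √(2 * Real.pi) := by
    have := integral_gaussian (1 / 2)
    rw [show Real.pi / (1 / 2) = 2 * Real.pi by ring] at this
    rw [← this]
    congr 1; ext y; congr 1; ring
  have hsplit : (∫ y in Iic z, Real.exp (-(y ^ 2) / 2)) + ∫ y in Ioi z, Real.exp (-(y ^ 2) / 2) =
      √(2 * Real.pi) := by
    rw [← htot, ← compl_Iic]
    exact integral_add_compl measurableSet_Iic hinteg
  have hscale : ∫ v in Ioi |x|, Real.exp (-s * v ^ 2) =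
      (√(2 * s))⁻¹ * ∫ y in Ioi z, Real.exp (-(y ^ 2) / 2) := by
    have := integral_comp_mul_left_Ioi (fun y => Real.exp (-(y ^ 2) / 2)) |x| hs2
    rw [smul_eq_mul, ← hz] at this
    rw [← this]
    congr 1; ext v; congr 1
    rw [mul_pow, Real.sq_sqrt (by linarith)]; ring
  have hpi := Real.pi_pos
  have hp2 : 0 < √(2 * Real.pi) := Real.sqrt_pos.2 (by linarith)
  have hkey : √(s * Real.pi) * √(2 * s) = s * √(2 * Real.pi) := by
    rw [← Real.sqrt_mul (by positivity), show s * Real.pi * (2 * s) = s ^ 2 * (2 * Real.pi) by ring,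
      Real.sqrt_mul (by positivity), Real.sqrt_sq hs.le]
  rw [phiHat, stdNormalCdf, ← hz, hscale, eq_sub_of_add_eq hsplit]
  generalize ∫ y in Ioi z, Real.exp (-(y ^ 2) / 2) = J
  field_simp
  rw [mul_comm s 2, mul_comm Real.pi 2]
  linear_combination J * hkey

end SelfRepelling

namespace SelfRepelling

open Set

lemma tendsto_mul_one_sub_exp_neg_div (s : ℝ) :
    Tendsto (fun A : ℝ => A * (1 - Real.exp (-s / A))) atTop (𝓝 s) := by
  have hd : HasDerivAt (fun u : ℝ => -Real.exp (-s * u)) s 0 := by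
    have := (((hasDerivAt_id (0 : ℝ)).const_mul (-s)).exp).neg
    exact this.congr_deriv (by simp)
  have h := hd.tendsto_slope.comp ((tendsto_inv_atTop_nhdsGT_zero (𝕜 := ℝ)).mono_right
    (nhdsWithin_mono _ fun u hu => (ne_of_gt hu : u ≠ 0)))
  refine h.congr' ?_
  filter_upwards [eventually_gt_atTop 0] with A hA
  simp [slope_def_field, div_eq_mul_inv]
  ring

lemma tendsto_floor_sqrt_mul_div (x : ℝ) :
    Tendsto (fun A : ℝ => ((⌊√A * x⌋ : ℤ) : ℝ) / √A) atTop (𝓝 x) := by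
  have hinv : Tendsto (fun A : ℝ => x - (√A)⁻¹) atTop (𝓝 x) := by
    simpa using tendsto_const_nhds.sub (tendsto_inv_atTop_zero.comp Real.tendsto_sqrt_atTop)
  refine tendsto_of_tendsto_of_tendsto_of_le_of_le' hinv tendsto_const_nhds ?_ ?_ <;>
    filter_upwards [eventually_gt_atTop 0] with A hA
  · have h := Real.sqrt_pos.2 hA
    rw [le_div_iff₀ h, sub_mul, inv_mul_cancel₀ h.ne', mul_comm x]
    exact (Int.sub_one_lt_floor _).le
  · have h := Real.sqrt_pos.2 hA
    rw [div_le_iff₀ h, mul_comm x]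
    exact Int.floor_le _

lemma tendsto_floor_add_one_div {t : ℝ} (ht : 0 ≤ t) :
    Tendsto (fun A : ℝ => ((⌊A * t⌋₊ + 1 : ℕ) : ℝ) / A) atTop (𝓝 t) := by
  have h := (tendsto_nat_floor_mul_div_atTop ht).add tendsto_inv_atTop_zero
  rw [add_zero] at h
  refine h.congr fun A => ?_
  push_cast
  rw [mul_comm t, add_div, one_div]

/-- If the discrepancy between `f` and `max (√n - |k|) 0` is `o(√n)` uniformly in `k`, then `f`
has the diffusive scaling limit `max (√t - |x|) 0`. -/
lemma tendsto_div_sqrt_of_abs_sub_le {f : ℕ → ℤ → ℝ}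
    (hf : ∀ a > 0, ∃ C, ∀ (n : ℕ) (k : ℤ), |f n k - max (√n - |(k : ℝ)|) 0| ≤ a * √n + C)
    {t : ℝ} (ht : 0 ≤ t) (x : ℝ) :
    Tendsto (fun A : ℝ => f (⌊A * t⌋₊ + 1) ⌊√A * x⌋ / √A) atTop (𝓝 (max (√t - |x|) 0)) := by
  set N : ℝ → ℝ := fun A => ((⌊A * t⌋₊ + 1 : ℕ) : ℝ) with hN
  have hs : Tendsto (fun A => √(N A) / √A) atTop (𝓝 √t) := by
    refine ((Real.continuous_sqrt.tendsto t).comp (tendsto_floor_add_one_div ht)).congr fun A => ?_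
    exact Real.sqrt_div (Nat.cast_nonneg _) A
  have hm : Tendsto (fun A : ℝ => max (√(N A) - |((⌊√A * x⌋ : ℤ) : ℝ)|) 0 / √A) atTop
      (𝓝 (max (√t - |x|) 0)) := by
    refine ((hs.sub (tendsto_floor_sqrt_mul_div x).abs).max tendsto_const_nhds).congr' ?_
    filter_upwards [eventually_gt_atTop 0] with A hA
    have h := Real.sqrt_pos.2 hA
    rw [abs_div, abs_of_pos h, ← sub_div, ← max_div_div_right h.le, zero_div]
  have hd : Tendsto (fun A : ℝ => f (⌊A * t⌋₊ + 1) ⌊√A * x⌋ / √A -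
      max (√(N A) - |((⌊√A * x⌋ : ℤ) : ℝ)|) 0 / √A) atTop (𝓝 0) := by
    rw [Metric.tendsto_nhds]
    intro ε hε
    have hpos : 0 < √t + 1 := by positivity
    obtain ⟨C, hC⟩ := hf (ε / 2 / (√t + 1)) (by positivity)
    have hb : Tendsto (fun A : ℝ => ε / 2 / (√t + 1) * (√(N A) / √A) + C * (√A)⁻¹) atTop
        (𝓝 (ε / 2 / (√t + 1) * √t + C * 0)) :=
      (hs.const_mul _).add ((tendsto_inv_atTop_zero.comp Real.tendsto_sqrt_atTop).const_mul C)
    have hlt : ε / 2 / (√t + 1) * √t + C * 0 < ε := by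
      rw [mul_zero, add_zero, div_mul_eq_mul_div, div_lt_iff₀ hpos]
      nlinarith [Real.sqrt_nonneg t]
    filter_upwards [eventually_gt_atTop 0, hb.eventually (gt_mem_nhds hlt)] with A hA hlt
    have h := Real.sqrt_pos.2 hA
    rw [Real.dist_0_eq_abs, ← sub_div, abs_div, abs_of_pos h]
    refine lt_of_le_of_lt ?_ hlt
    rw [← mul_div_assoc, ← div_eq_mul_inv, ← add_div]
    gcongr
    exact hC _ _
  simpa using hd.add hm

lemma tendsto_mul_tsum_exp_mul {P : ℕ → ℤ → ℝ} (hP0 : ∀ n k, 0 ≤ P n k) (hP1 : ∀ n k, P n k ≤ 1)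
    (hP : ∀ a > 0, ∃ C, ∀ (n : ℕ) (k : ℤ),
      |∑ i ∈ Finset.range n, P i k - max (√n - |(k : ℝ)|) 0| ≤ a * √n + C)
    {s : ℝ} (hs : 0 < s) (x : ℝ) :
    Tendsto (fun A : ℝ => √A * ((1 - Real.exp (-s / A)) *
      ∑' n : ℕ, Real.exp (-s * n / A) * P n ⌊√A * x⌋)) atTop (𝓝 (phiHat s x)) := by
  obtain ⟨C, hC⟩ := hP 1 one_pos
  have hC0 : 0 ≤ C := by simpa using (abs_nonneg _).trans (hC 0 0)
  have hPa : ∀ n k, |P n k| ≤ 1 := fun n k => abs_le.2 ⟨by linarith [hP0 n k], hP1 n k⟩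
  have hinteg : Tendsto (fun A : ℝ => ∫ t in Ioi (0 : ℝ), s * Real.exp (-s * t) *
      ((∑ i ∈ Finset.range (⌊A * t⌋₊ + 1), P i ⌊√A * x⌋) / √A)) atTop
      (𝓝 (∫ t in Ioi (0 : ℝ), s * Real.exp (-s * t) * max (√t - |x|) 0)) := by
    refine tendsto_integral_filter_of_dominated_convergence
      (fun t => s * Real.exp (-s * t) * (2 * t + (4 + C))) (Eventually.of_forall fun A => ?_) ?_
      (integrableOn_exp_mul_affine hs _ _) ?_
    · refine (Measurable.mul (by fun_prop) (Measurable.div_const ?_ _)).aestronglyMeasurable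
      exact (measurable_from_top (f := fun n : ℕ => ∑ i ∈ Finset.range (n + 1), P i ⌊√A * x⌋)).comp
        (Nat.measurable_floor.comp (by fun_prop))
    · filter_upwards [eventually_ge_atTop 1] with A hA
      filter_upwards [ae_restrict_mem measurableSet_Ioi] with t ht
      have ht0 : 0 < t := ht
      have hA0 : 0 < A := by linarith
      have hsA : 1 ≤ √A := Real.one_le_sqrt.2 hA
      rw [norm_mul, Real.norm_of_nonneg (by positivity : 0 ≤ s * Real.exp (-s * t)),
        Real.norm_of_nonneg (div_nonneg (Finset.sum_nonneg fun i _ => hP0 i _) (by positivity))]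
      refine mul_le_mul_of_nonneg_left ?_ (by positivity)
      rw [div_le_iff₀ (by positivity)]
      have h1 := (abs_le.1 (hC (⌊A * t⌋₊ + 1) ⌊√A * x⌋)).2
      have h2 : max (√((⌊A * t⌋₊ + 1 : ℕ) : ℝ) - |((⌊√A * x⌋ : ℤ) : ℝ)|) 0 ≤
          √((⌊A * t⌋₊ + 1 : ℕ) : ℝ) :=
        max_le (sub_le_self _ (abs_nonneg _)) (Real.sqrt_nonneg _)
      have h3 : √((⌊A * t⌋₊ + 1 : ℕ) : ℝ) ≤ (t + 1) * √A := by
        have hfl := Nat.floor_le (mul_pos hA0 ht0).le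
        refine Real.sqrt_le_iff.2 ⟨by positivity, ?_⟩
        rw [mul_pow, Real.sq_sqrt hA0.le]
        push_cast
        nlinarith [mul_pos hA0 ht0, mul_pos hA0 (mul_pos ht0 ht0)]
      have h4 : C ≤ C * √A := le_mul_of_one_le_right hC0 hsA
      nlinarith
    · filter_upwards [ae_restrict_mem measurableSet_Ioi] with t ht
      exact (tendsto_div_sqrt_of_abs_sub_le (f := fun n k => ∑ i ∈ Finset.range n, P i k) hP
        (le_of_lt ht) x).const_mul _
  rw [integral_exp_mul_max_sqrt hs (abs_nonneg x)] at hinteg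
  rw [phiHat_eq hs]
  refine ((tendsto_mul_one_sub_exp_neg_div s).mul hinteg).congr' ?_
  filter_upwards [eventually_gt_atTop 0] with A hA
  have h := Real.sqrt_pos.2 hA
  rw [tsum_exp_mul_eq hs hA fun n => hPa n _]
  simp only [← mul_div_assoc]
  rw [integral_div]
  generalize ∫ t in Ioi (0 : ℝ), s * Real.exp (-s * t) *
    ∑ i ∈ Finset.range (⌊A * t⌋₊ + 1), P i ⌊√A * x⌋ = J
  rw [← mul_div_assoc, div_eq_iff h.ne']
  linear_combination -(1 - Real.exp (-s / A)) * J * Real.mul_self_sqrt hA.le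

end SelfRepelling

/-- local limit theorem at an independent geometric time:
`A^{1/2} Pr(X(θ_{s/A}) = ⌊A^{1/2}x⌋) → φ̂(s,x)` as `A → ∞`, for almost every `x`.
Here `Pr(X(θ_{s/A}) = k) = (1 - e^{-s/A}) ∑_n e^{-sn/A} Pr(X(n) = k)` since `θ_{s/A}`
is geometric and independent of `X`. -/
theorem stmt_17 (w : ℤ → ℝ) (hw : GoodWeight w)
    {Ω : Type*} [MeasurableSpace Ω] (μ : Measure Ω) [IsProbabilityMeasure μ]
    (X : ℕ → Ω → ℤ) (hX : IsSRW μ w X) (s : ℝ) (hs : 0 < s) :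
    ∀ᵐ x : ℝ,
      Tendsto (fun A : ℝ => Real.sqrt A * ((1 - Real.exp (-s / A)) *
          ∑' n : ℕ, Real.exp (-s * n / A) *
            (μ {ω | X n ω = ⌊Real.sqrt A * x⌋}).toReal))
        atTop (𝓝 (phiHat s x)) := by
  refine ae_of_all _ fun x => ?_
  exact SelfRepelling.tendsto_mul_tsum_exp_mul (P := fun n k => μ.real {ω | X n ω = k})
    (fun _ _ => measureReal_nonneg) (fun _ _ => measureReal_le_one)
    (fun a ha => SelfRepelling.abs_sum_measureReal_sub_le hw hX ha) hs x
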